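/- arXiv:2212.09341 — 3 statements merged into one kernel-verified Lean document; each statement's English description precedes it below -/
import Mathlib

section
/- For every λ ∈ L₀^#, every positive integer γ, and every K ∈ ℤ^{(n+2)×(n+2)} with KᵀS₀K = S₀, one has a(Kλ, γ) = a(λ, γ). -/
open Matrix Complex

namespace OEis

/-- Extension of an even Gram matrix by a hyperbolic plane:
`[[0,0,1],[0,A,0],[1,0,0]]`. -/
def hyp {m : ℕ} (A : Matrix (Fin m) (Fin m) ℤ) :
    Matrix (Fin (m + 2)) (Fin (m + 2)) ℤ := fun i j =>
  if hi0 : (i : ℕ) = 0 then (if (j : ℕ) = m + 1 then 1 else 0)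
  else if him : (i : ℕ) = m + 1 then (if (j : ℕ) = 0 then 1 else 0)
  else if hj0 : (j : ℕ) = 0 then 0
  else if hjm : (j : ℕ) = m + 1 then 0
  else A ⟨(i : ℕ) - 1, by have := i.isLt; omega⟩ ⟨(j : ℕ) - 1, by have := j.isLt; omega⟩

variable (n : ℕ) (S : Matrix (Fin n) (Fin n) ℤ)

/-- `S₀ = [[0,0,1],[0,-S,0],[1,0,0]]`. -/
def MatS0 : Matrix (Fin (n + 2)) (Fin (n + 2)) ℤ := hyp (-S)

/-- `S₁ = [[0,0,1],[0,S₀,0],[1,0,0]]`. -/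
def MatS1 : Matrix (Fin (n + 4)) (Fin (n + 4)) ℤ := hyp (MatS0 n S)

/-- Bilinear form `uᵀ A v` over a field `K`. -/
def bilin {m : ℕ} (K : Type) [Field K] (A : Matrix (Fin m) (Fin m) ℤ)
    (u v : Fin m → K) : K :=
  u ⬝ᵥ (A.map (Int.cast : ℤ → K)).mulVec v

/-- Quadratic form `Q_A(v) = vᵀAv/2` over a field `K`. -/
def quadF {m : ℕ} (K : Type) [Field K] (A : Matrix (Fin m) (Fin m) ℤ)
    (v : Fin m → K) : K := bilin K A v v / 2

/-- First component of a vector. -/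
def vfirst {m : ℕ} {K : Type} (g : Fin (m + 2) → K) : K := g ⟨0, by omega⟩

/-- Last component of a vector. -/
def vlast {m : ℕ} {K : Type} (g : Fin (m + 2) → K) : K := g ⟨m + 1, by omega⟩

/-- Middle components of a vector. -/
def vmid {m : ℕ} {K : Type} (g : Fin (m + 2) → K) : Fin m → K :=
  fun i => g ⟨(i : ℕ) + 1, by have := i.isLt; omega⟩

/-- gcd of the entries of a rational vector (via numerators). -/
def ratGcd {m : ℕ} (v : Fin m → ℚ) : ℕ :=
  Finset.gcd Finset.univ fun i => (v i).num.natAbs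

/-- `v` has integral entries. -/
def inLat {m : ℕ} (v : Fin m → ℚ) : Prop := ∀ i, ∃ z : ℤ, v i = (z : ℚ)

/-- `g ∈ ℤ^m + c`. -/
def inLatShift {m : ℕ} (c g : Fin m → ℚ) : Prop := ∀ i, ∃ z : ℤ, g i - c i = (z : ℚ)

/-- Membership in the dual lattice `A⁻¹ℤ^m`, i.e. `Av` is integral. -/
def inDual {m : ℕ} (A : Matrix (Fin m) (Fin m) ℤ) (v : Fin m → ℚ) : Prop :=
  ∀ i, ∃ z : ℤ, ((A.map (Int.cast : ℤ → ℚ)).mulVec v) i = (z : ℚ)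

/-- The positive cone `P_S`. -/
def PosCone : Set (Fin (n + 2) → ℝ) :=
  {y | 0 < quadF ℝ (MatS0 n S) y ∧ 0 < y ⟨0, by omega⟩}

/-- The tube domain `H_S`. -/
def HS : Set (Fin (n + 2) → ℂ) :=
  {z | (fun i => (z i).im) ∈ PosCone n S}

/-- Automorphy factor attached to a vector:
`j(g,z) = -γ Q₀(z) + (d,z)₀ + δ` for `g = (δ,dᵀ,γ)ᵀ`. -/
noncomputable def jay (g : Fin (n + 4) → ℚ) (z : Fin (n + 2) → ℂ) : ℂ :=
  -((vlast g : ℚ) : ℂ) * quadF ℂ (MatS0 n S) z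
    + bilin ℂ (MatS0 n S) (fun i => ((vmid g i : ℚ) : ℂ)) z
    + ((vfirst g : ℚ) : ℂ)

/-- The index set of the Eisenstein series attached to a cusp `c`:
`{g ∈ L₁ + c : Q₁(g) = 0, gcd(S₁g) = 1}`. -/
def cuspSet (c : Fin (n + 4) → ℚ) : Set (Fin (n + 4) → ℚ) :=
  {g | inLatShift c g ∧ quadF ℚ (MatS1 n S) g = 0 ∧
    ratGcd (((MatS1 n S).map (Int.cast : ℤ → ℚ)).mulVec g) = 1}

/-- The standard-form cusp vector `(1, 0, 𝔠ᵀ, 0, Q(𝔠))ᵀ`. -/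
def stdCuspVec (fc : Fin n → ℚ) : Fin (n + 4) → ℚ := fun i =>
  if h0 : (i : ℕ) = 0 then 1
  else if h3 : (i : ℕ) = n + 3 then quadF ℚ S fc
  else if h12 : (i : ℕ) = 1 ∨ (i : ℕ) = n + 2 then 0
  else fc ⟨(i : ℕ) - 2, by have := i.isLt; omega⟩

/-- `c` is a standard-form cusp. -/
def IsStdCusp (c : Fin (n + 4) → ℚ) : Prop :=
  ∃ fc : Fin n → ℚ, inDual S fc ∧ (∃ z : ℤ, quadF ℚ S fc = (z : ℚ)) ∧
    c = stdCuspVec n S fc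

/-- The real orthogonal group of `A`. -/
def OSet {m : ℕ} (A : Matrix (Fin m) (Fin m) ℤ) : Set (Matrix (Fin m) (Fin m) ℝ) :=
  {M | Mᵀ * A.map (Int.cast : ℤ → ℝ) * M = A.map (Int.cast : ℤ → ℝ)}

/-- Connected component of the identity in the real orthogonal group. -/
def OPlus {m : ℕ} (A : Matrix (Fin m) (Fin m) ℤ) : Set (Matrix (Fin m) (Fin m) ℝ) :=
  connectedComponentIn (OSet A) 1

/-- `Γ_S`: integral matrices in `O⁺(S₁;ℝ)`. -/
def GammaS : Set (Matrix (Fin (n + 4)) (Fin (n + 4)) ℝ) :=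
  {M | M ∈ OPlus (MatS1 n S) ∧ ∀ i j, ∃ z : ℤ, M i j = (z : ℝ)}

/-- The discriminant kernel `Γ̃_S`. -/
def GammaTilde : Set (Matrix (Fin (n + 4)) (Fin (n + 4)) ℝ) :=
  {M | M ∈ GammaS n S ∧
    ∃ X : Matrix (Fin (n + 4)) (Fin (n + 4)) ℤ,
      M = 1 + (X * MatS1 n S).map (Int.cast : ℤ → ℝ)}

/-- Automorphy factor of a matrix: `j(M,z) = -γ Q₀(z) + (d,z)₀ + δ`
where `(γ, dᵀS₀, δ)` is the bottom row of `M`. -/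
noncomputable def jayM (M : Matrix (Fin (n + 4)) (Fin (n + 4)) ℝ)
    (z : Fin (n + 2) → ℂ) : ℂ :=
  -((M ⟨n + 3, by omega⟩ ⟨0, by omega⟩ : ℝ) : ℂ) * quadF ℂ (MatS0 n S) z
    + ∑ i : Fin (n + 2),
        ((M ⟨n + 3, by omega⟩ ⟨(i : ℕ) + 1, by have := i.isLt; omega⟩ : ℝ) : ℂ) * z i
    + ((M ⟨n + 3, by omega⟩ ⟨n + 3, by omega⟩ : ℝ) : ℂ)

/-- The action `M⟨z⟩ = (-Q₀(z)·b + Kz + c')·j(M,z)⁻¹`. -/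
noncomputable def actM (M : Matrix (Fin (n + 4)) (Fin (n + 4)) ℝ)
    (z : Fin (n + 2) → ℂ) : Fin (n + 2) → ℂ := fun i =>
  (-(quadF ℂ (MatS0 n S) z) *
      ((M ⟨(i : ℕ) + 1, by have := i.isLt; omega⟩ ⟨0, by omega⟩ : ℝ) : ℂ)
    + ∑ j : Fin (n + 2),
        ((M ⟨(i : ℕ) + 1, by have := i.isLt; omega⟩
            ⟨(j : ℕ) + 1, by have := j.isLt; omega⟩ : ℝ) : ℂ) * z j
    + ((M ⟨(i : ℕ) + 1, by have := i.isLt; omega⟩ ⟨n + 3, by omega⟩ : ℝ) : ℂ))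
  * (jayM n S M z)⁻¹

/-- The integral vector `(−Q₀(d)/γ, dᵀ, γ)ᵀ` built from `d` and `γ`. -/
def gExt (d : Fin (n + 2) → ℕ) (γ : ℕ) : Fin (n + 4) → ℚ := fun i =>
  if h0 : (i : ℕ) = 0 then -(quadF ℚ (MatS0 n S) fun j => (d j : ℚ)) / γ
  else if h3 : (i : ℕ) = n + 3 then (γ : ℚ)
  else (d ⟨(i : ℕ) - 1, by have := i.isLt; omega⟩ : ℚ)

open scoped Classical in
/-- The Dirichlet coefficient `a(λ,γ)`. -/
noncomputable def aCoef (lam : Fin (n + 2) → ℚ) (γ : ℕ) : ℂ :=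
  ∑ d ∈ Fintype.piFinset fun _ : Fin (n + 2) => Finset.range γ,
    if (∃ e : ℤ, quadF ℚ (MatS0 n S) (fun j => (d j : ℚ)) = (γ : ℚ) * e) ∧
        ratGcd (((MatS1 n S).map (Int.cast : ℤ → ℚ)).mulVec (gExt n S d γ)) = 1 then
      Complex.exp (2 * Real.pi * Complex.I *
        ((bilin ℚ (MatS0 n S) lam (fun j => (d j : ℚ)) / γ : ℚ) : ℂ))
    else 0

/-- The convolution `b(λ,γ) = Σ_{δ∣γ} a(λ,δ)`. -/
noncomputable def bCoef (lam : Fin (n + 2) → ℚ) (γ : ℕ) : ℂ :=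
  ∑ δ ∈ γ.divisors, aCoef n S lam δ

/-- The order/level of a rational vector: least `N ≥ 1` with `Nv` integral. -/
noncomputable def ordv {m : ℕ} (v : Fin m → ℚ) : ℕ :=
  sInf {N : ℕ | 0 < N ∧ ∀ i, ∃ z : ℤ, (N : ℚ) * v i = (z : ℚ)}

/-- `S` is `p`-maximal. -/
def pMaximal (p : ℕ) : Prop :=
  ∀ v : Fin n → ℚ, inDual S v → (∃ z : ℤ, quadF ℚ S v = (z : ℚ)) → ¬ p ∣ ordv v

/-- The vector `(l, μᵀ, m)ᵀ ∈ ℚ^{n+2}`. -/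
def asmVec (l : ℚ) (μ : Fin n → ℚ) (m : ℚ) : Fin (n + 2) → ℚ := fun i =>
  if h0 : (i : ℕ) = 0 then l
  else if h1 : (i : ℕ) = n + 1 then m
  else μ ⟨(i : ℕ) - 1, by have := i.isLt; omega⟩

open scoped Classical in
/-- The representation number `N(λ, p^ν, p^t)`. -/
noncomputable def Ncount (lam : Fin (n + 2) → ℚ) (p νl ν t : ℕ) : ℕ :=
  ((Fintype.piFinset fun _ : Fin n => Finset.range (p ^ ν)).filter fun v =>
    (∃ e : ℤ, quadF ℚ S (fun i => (v i : ℚ)) = (p : ℚ) ^ (t : ℕ) * e) ∧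
    (∃ e : ℤ, (p : ℚ) ^ ((νl : ℤ) - (t : ℤ)) * quadF ℚ S (fun i => (v i : ℚ))
        - bilin ℚ S (fun i => (v i : ℚ)) (vmid lam)
        + (p : ℚ) ^ ((t : ℤ) - (νl : ℤ)) * lam ⟨0, by omega⟩ * lam ⟨n + 1, by omega⟩
      = (p : ℚ) ^ (ν : ℕ) * e)).card

/-- `N*(λ,p^ν) = Σ_{t=0}^{min(ν,ν_λ)} N(λ,p^ν,p^t)`. -/
noncomputable def Nstar (lam : Fin (n + 2) → ℚ) (p νl ν : ℕ) : ℕ :=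
  ∑ t ∈ Finset.range (min ν νl + 1), Ncount n S lam p νl ν t

/-- Kloosterman sum `K(α,β;γ)` (with `β` allowed rational;
in all uses `β` is an integer). -/
noncomputable def kloos (α : ℤ) (β : ℚ) (γ : ℕ) : ℂ :=
  ∑ j ∈ Finset.range γ,
    if Nat.Coprime j γ then
      Complex.exp (2 * Real.pi * Complex.I *
        ((((α : ℚ) * j + β * ((((j : ZMod γ)⁻¹).val : ℕ) : ℚ)) / γ : ℚ) : ℂ))
    else 0

/-- `q ≡ 0 (mod p^k)` in `ℤ_p`, for a rational `q`. -/
def pCong (p k : ℕ) (q : ℚ) : Prop :=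
  q = 0 ∨ (k : ℤ) ≤ padicValRat p q

/-- The constant `c_{k,S}^• = (2π)^{2k-n/2}/(√(det S)·Γ(k)·Γ(k-n/2))`. -/
noncomputable def ckS (k : ℕ) : ℝ :=
  (2 * Real.pi) ^ ((2 * k : ℝ) - n / 2) /
    (Real.sqrt ((S.det : ℤ) : ℝ) * Real.Gamma (k : ℝ) * Real.Gamma ((k : ℝ) - n / 2))

end OEis

open OEis

namespace OEis

theorem map_intCast_int {m : ℕ} (A : Matrix (Fin m) (Fin m) ℤ) :
    A.map (Int.cast : ℤ → ℤ) = A := by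
  ext
  simp

section Hyperbolic

variable {m : ℕ} (A : Matrix (Fin m) (Fin m) ℤ)

theorem hyp_isSymm (hA : A.IsSymm) : (hyp A).IsSymm := by
  refine Matrix.IsSymm.ext fun i j => ?_
  unfold hyp
  split_ifs <;> first | rfl | omega | exact hA.apply _ _

theorem sum_fin_ends {M : Type*} [AddCommMonoid M] (f : Fin (m + 2) → M) :
    ∑ i, f i = f 0 + ∑ i : Fin m, f i.succ.castSucc + f (Fin.last (m + 1)) := by
  rw [Fin.sum_univ_castSucc, Fin.sum_univ_succ]
  rfl

variable {R : Type*} [CommRing R] (w : Fin (m + 2) → R)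

theorem hyp_mulVec_zero :
    ((hyp A).map (Int.cast : ℤ → R) *ᵥ w) 0 = w (Fin.last (m + 1)) := by
  have h (i : Fin m) : (i : ℕ) ≠ m := i.isLt.ne
  simp [mulVec, dotProduct, sum_fin_ends, hyp, h]

theorem hyp_mulVec_last :
    ((hyp A).map (Int.cast : ℤ → R) *ᵥ w) (Fin.last (m + 1)) = w 0 := by
  simp [mulVec, dotProduct, hyp]

theorem hyp_mulVec_mid (i : Fin m) :
    ((hyp A).map (Int.cast : ℤ → R) *ᵥ w) i.succ.castSucc =
      (A.map (Int.cast : ℤ → R) *ᵥ fun j => w j.succ.castSucc) i := by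
  have h (i : Fin m) : (i : ℕ) ≠ m := i.isLt.ne
  simp [mulVec, dotProduct, sum_fin_ends, hyp, h]

theorem forall_fin_ends {p : Fin (m + 2) → Prop} :
    (∀ i, p i) ↔ p 0 ∧ (∀ i : Fin m, p i.succ.castSucc) ∧ p (Fin.last (m + 1)) := by
  rw [Fin.forall_fin_succ', Fin.forall_fin_succ, and_assoc]
  rfl

theorem hyp_even (hA : ∀ v : Fin m → ℤ, 2 ∣ v ⬝ᵥ A *ᵥ v) (v : Fin (m + 2) → ℤ) :
    2 ∣ v ⬝ᵥ hyp A *ᵥ v := by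
  obtain ⟨c, hc⟩ := hA fun j => v j.succ.castSucc
  have h0 := hyp_mulVec_zero A v
  have h1 := hyp_mulVec_last A v
  have h2 := hyp_mulVec_mid A v
  rw [map_intCast_int] at h0 h1
  simp only [map_intCast_int] at h2
  refine ⟨v 0 * v (Fin.last (m + 1)) + c, ?_⟩
  rw [dotProduct, sum_fin_ends, h0, h1]
  simp only [h2]
  rw [dotProduct] at hc
  rw [hc]
  ring

theorem hyp_det_ne_zero (hA : A.det ≠ 0) : (hyp A).det ≠ 0 := by
  intro h
  obtain ⟨v, hv, hAv⟩ := Matrix.exists_mulVec_eq_zero_iff.2 h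
  have h0 := hyp_mulVec_zero A v
  have h1 := hyp_mulVec_last A v
  have h2 := hyp_mulVec_mid A v
  simp only [map_intCast_int, hAv, Pi.zero_apply] at h0 h1 h2
  have h3 : (fun j : Fin m => v j.succ.castSucc) = 0 :=
    Matrix.eq_zero_of_mulVec_eq_zero hA (funext fun i => (h2 i).symm)
  exact hv (funext (forall_fin_ends.2 ⟨h1.symm, congrFun h3, h0.symm⟩))

end Hyperbolic

theorem det_ne_zero_of_bilin_pos {m : ℕ} (A : Matrix (Fin m) (Fin m) ℤ)
    (hpos : ∀ v : Fin m → ℝ, v ≠ 0 → 0 < bilin ℝ A v v) : A.det ≠ 0 := by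
  intro h
  obtain ⟨v, hv, hAv⟩ := Matrix.exists_mulVec_eq_zero_iff.2 h
  have hv' : (fun i => (v i : ℝ)) ≠ 0 := fun h0 =>
    hv (funext fun i => by simpa using congrFun h0 i)
  have h0 : A.map (Int.cast : ℤ → ℝ) *ᵥ (fun i => (v i : ℝ)) = 0 := by
    funext i
    have := congrArg (Int.cast : ℤ → ℝ) (congrFun hAv i)
    simpa [mulVec, dotProduct] using this
  have := hpos _ hv'
  simp [bilin, h0] at this

theorem map_mulVec_intCast {m : ℕ} (A : Matrix (Fin m) (Fin m) ℤ) (R : Type*) [CommRing R]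
    (v : Fin m → ℤ) :
    A.map (Int.cast : ℤ → R) *ᵥ (fun i => (v i : R)) = fun i => (((A *ᵥ v) i : ℤ) : R) := by
  funext i
  simp [mulVec, dotProduct]

theorem quadF_intCast {m : ℕ} (A : Matrix (Fin m) (Fin m) ℤ) (v : Fin m → ℤ) :
    quadF ℚ A (fun i => (v i : ℚ)) = ((v ⬝ᵥ A *ᵥ v : ℤ) : ℚ) / 2 := by
  rw [quadF, bilin, map_mulVec_intCast]
  simp [dotProduct]

theorem ratGcd_intCast_eq_one {m : ℕ} (w : Fin m → ℤ) :
    ratGcd (fun i => (w i : ℚ)) = 1 ↔ ∀ p : ℕ, (∀ i, (p : ℤ) ∣ w i) → p = 1 := by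
  have h (p : ℕ) : p ∣ ratGcd (fun i => (w i : ℚ)) ↔ ∀ i, (p : ℤ) ∣ w i := by
    simp [ratGcd, Finset.dvd_gcd_iff, Int.natCast_dvd]
  simp only [← h]
  exact ⟨fun h1 p hp => Nat.dvd_one.1 (h1 ▸ hp), fun h1 => h1 _ dvd_rfl⟩

/-- `γ ∣ Q_A(d)` and `γ`, `Ad`, `Q_A(d)/γ` have no common divisor other than `1`. -/
def IsAdmissible {m : ℕ} (A : Matrix (Fin m) (Fin m) ℤ) (γ : ℕ) (d : Fin m → ℤ) : Prop :=
  ∃ e : ℤ, d ⬝ᵥ A *ᵥ d = 2 * γ * e ∧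
    ∀ p : ℕ, (p : ℤ) ∣ γ → (∀ i, (p : ℤ) ∣ (A *ᵥ d) i) → (p : ℤ) ∣ e → p = 1

open scoped Classical in
/-- The summand of the Dirichlet coefficient at an arbitrary integral vector. -/
noncomputable def admissibleTerm {m : ℕ} (A : Matrix (Fin m) (Fin m) ℤ) (lam : Fin m → ℚ)
    (γ : ℕ) (d : Fin m → ℤ) : ℂ :=
  if IsAdmissible A γ d then
    Complex.exp (2 * Real.pi * Complex.I * ((bilin ℚ A lam (fun j => (d j : ℚ)) / γ : ℚ) : ℂ))
  else 0

section Invariance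

variable {m : ℕ} {A : Matrix (Fin m) (Fin m) ℤ} {γ : ℕ}

theorem dvd_mulVec {p : ℤ} (B : Matrix (Fin m) (Fin m) ℤ) {v : Fin m → ℤ} (hv : ∀ i, p ∣ v i)
    (i : Fin m) : p ∣ (B *ᵥ v) i := by
  rw [mulVec, dotProduct]
  exact Finset.dvd_sum fun j _ => (hv j).mul_left _

theorem IsAdmissible.add_smul (hA : A.IsSymm) (heven : ∀ v : Fin m → ℤ, 2 ∣ v ⬝ᵥ A *ᵥ v)
    {d : Fin m → ℤ} (hd : IsAdmissible A γ d) (x : Fin m → ℤ) :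
    IsAdmissible A γ (d + (γ : ℤ) • x) := by
  obtain ⟨e, he, hp⟩ := hd
  obtain ⟨q, hq⟩ := heven x
  have hdx : d ⬝ᵥ A *ᵥ x = x ⬝ᵥ A *ᵥ d := by
    rw [dotProduct_mulVec, dotProduct_comm, ← mulVec_transpose, hA.eq]
  refine ⟨e + x ⬝ᵥ A *ᵥ d + γ * q, ?_, fun p hpγ hpA hpe => ?_⟩
  · simp only [mulVec_add, mulVec_smul, dotProduct_add, add_dotProduct, dotProduct_smul,
      smul_dotProduct, smul_eq_mul, he, hq, hdx]
    ring
  · have hpd (i : Fin m) : (p : ℤ) ∣ (A *ᵥ d) i := by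
      have := hpA i
      rw [mulVec_add, mulVec_smul, Pi.add_apply, Pi.smul_apply, smul_eq_mul] at this
      exact (dvd_add_left (hpγ.mul_right _)).1 this
    refine hp p hpγ hpd ?_
    rw [dvd_add_left (hpγ.mul_right _)] at hpe
    exact (dvd_add_left (Finset.dvd_sum fun i _ => (hpd i).mul_left _)).1 hpe

theorem isAdmissible_add_smul (hA : A.IsSymm) (heven : ∀ v : Fin m → ℤ, 2 ∣ v ⬝ᵥ A *ᵥ v)
    (d x : Fin m → ℤ) : IsAdmissible A γ (d + (γ : ℤ) • x) ↔ IsAdmissible A γ d :=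
  ⟨fun h => by simpa using h.add_smul hA heven (-x), fun h => h.add_smul hA heven x⟩

theorem isAdmissible_mulVec {K : Matrix (Fin m) (Fin m) ℤ} (hK : Kᵀ * A * K = A)
    (hunit : IsUnit K.det) (d : Fin m → ℤ) :
    IsAdmissible A γ (K *ᵥ d) ↔ IsAdmissible A γ d := by
  have hAd : A *ᵥ d = Kᵀ *ᵥ (A *ᵥ (K *ᵥ d)) := by
    rw [mulVec_mulVec, mulVec_mulVec, hK]
  have hAKd : A *ᵥ (K *ᵥ d) = (Kᵀ)⁻¹ *ᵥ (A *ᵥ d) := by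
    rw [hAd, mulVec_mulVec _ (Kᵀ)⁻¹ Kᵀ, nonsing_inv_mul _ (by rwa [det_transpose]), one_mulVec]
  have hQ : (K *ᵥ d) ⬝ᵥ A *ᵥ (K *ᵥ d) = d ⬝ᵥ A *ᵥ d := by
    rw [hAd, dotProduct_mulVec d, vecMul_transpose]
  unfold IsAdmissible
  rw [hQ]
  have hdvd (p : ℕ) : (∀ i, (p : ℤ) ∣ (A *ᵥ (K *ᵥ d)) i) ↔ ∀ i, (p : ℤ) ∣ (A *ᵥ d) i :=
    ⟨fun h => hAd ▸ dvd_mulVec _ h, fun h => hAKd ▸ dvd_mulVec _ h⟩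
  simp only [hdvd]

theorem bilin_isInt_of_inDual (hA : A.IsSymm) {lam : Fin m → ℚ} (hlam : inDual A lam)
    (x : Fin m → ℤ) : ∃ z : ℤ, bilin ℚ A lam (fun i => (x i : ℚ)) = z := by
  choose z hz using hlam
  refine ⟨z ⬝ᵥ x, ?_⟩
  rw [bilin, dotProduct_mulVec, ← mulVec_transpose, ← transpose_map, hA.eq]
  simp [dotProduct, hz]

theorem admissibleTerm_add_smul (hγ : 0 < γ) (hA : A.IsSymm)
    (heven : ∀ v : Fin m → ℤ, 2 ∣ v ⬝ᵥ A *ᵥ v) {lam : Fin m → ℚ} (hlam : inDual A lam)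
    (d x : Fin m → ℤ) :
    admissibleTerm A lam γ (d + (γ : ℤ) • x) = admissibleTerm A lam γ d := by
  unfold admissibleTerm
  classical
  refine if_congr (isAdmissible_add_smul hA heven d x) ?_ rfl
  obtain ⟨z, hz⟩ := bilin_isInt_of_inDual hA hlam x
  have hγ' : (γ : ℚ) ≠ 0 := by exact_mod_cast hγ.ne'
  have hb : bilin ℚ A lam (fun j => (((d + (γ : ℤ) • x) j : ℤ) : ℚ)) / γ =
      bilin ℚ A lam (fun j => (d j : ℚ)) / γ + z := by
    have hcast : (fun j => (((d + (γ : ℤ) • x) j : ℤ) : ℚ)) =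
        (fun j => (d j : ℚ)) + (γ : ℚ) • fun j => (x j : ℚ) := by
      funext j
      simp
    rw [← hz, hcast, bilin, mulVec_add, mulVec_smul, dotProduct_add, dotProduct_smul, smul_eq_mul]
    simp only [bilin]
    field_simp
  rw [hb, Complex.exp_eq_exp_iff_exists_int]
  refine ⟨z, ?_⟩
  push_cast
  ring

theorem admissibleTerm_mulVec {K : Matrix (Fin m) (Fin m) ℤ} (hK : Kᵀ * A * K = A)
    (hunit : IsUnit K.det) (lam : Fin m → ℚ) (d : Fin m → ℤ) :
    admissibleTerm A (K.map (Int.cast : ℤ → ℚ) *ᵥ lam) γ (K *ᵥ d) =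
      admissibleTerm A lam γ d := by
  unfold admissibleTerm
  classical
  refine if_congr (isAdmissible_mulVec hK hunit d) ?_ rfl
  have hKQ : (K.map (Int.cast : ℤ → ℚ))ᵀ * A.map (Int.cast : ℤ → ℚ) *
      K.map (Int.cast : ℤ → ℚ) = A.map (Int.cast : ℤ → ℚ) := by
    have := congrArg (fun M => M.map (Int.castRingHom ℚ)) hK
    rwa [Matrix.map_mul, Matrix.map_mul, transpose_map] at this
  have hb : bilin ℚ A (K.map (Int.cast : ℤ → ℚ) *ᵥ lam) (fun j => (((K *ᵥ d) j : ℤ) : ℚ)) =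
      bilin ℚ A lam (fun j => (d j : ℚ)) := by
    rw [← map_mulVec_intCast K ℚ d, bilin, bilin, ← vecMul_transpose, ← dotProduct_mulVec,
      mulVec_mulVec, mulVec_mulVec, hKQ]
  rw [hb]

theorem inDual_mulVec {K : Matrix (Fin m) (Fin m) ℤ} (hK : Kᵀ * A * K = A)
    (hunit : IsUnit K.det) {lam : Fin m → ℚ} (hlam : inDual A lam) :
    inDual A (K.map (Int.cast : ℤ → ℚ) *ᵥ lam) := by
  choose z hz using hlam
  have hAK : A * K = (Kᵀ)⁻¹ * A := by
    conv_rhs => rw [← hK, Matrix.mul_assoc, ← Matrix.mul_assoc,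
      nonsing_inv_mul _ (by rwa [det_transpose]), Matrix.one_mul]
  have hAKQ : A.map (Int.cast : ℤ → ℚ) * K.map (Int.cast : ℤ → ℚ) =
      (Kᵀ)⁻¹.map (Int.cast : ℤ → ℚ) * A.map (Int.cast : ℤ → ℚ) := by
    have := congrArg (fun M => M.map (Int.castRingHom ℚ)) hAK
    rwa [Matrix.map_mul, Matrix.map_mul] at this
  intro i
  refine ⟨((Kᵀ)⁻¹ *ᵥ z) i, ?_⟩
  rw [mulVec_mulVec, hAKQ, ← mulVec_mulVec, funext hz, map_mulVec_intCast]

theorem isUnit_det_of_transpose_mul_mul (hA : A.det ≠ 0) {K : Matrix (Fin m) (Fin m) ℤ}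
    (hK : Kᵀ * A * K = A) : IsUnit K.det := by
  have h := congrArg det hK
  rw [det_mul, det_mul, det_transpose] at h
  refine .of_mul_eq_one K.det (mul_left_cancel₀ hA ?_)
  linear_combination h

end Invariance

theorem sum_val_mulVec {m γ : ℕ} [NeZero γ] {K : Matrix (Fin m) (Fin m) ℤ}
    (hunit : IsUnit K.det) {f : (Fin m → ℤ) → ℂ}
    (hf : ∀ d x : Fin m → ℤ, f (d + (γ : ℤ) • x) = f d) :
    ∑ v : Fin m → ZMod γ, f (fun i => ((v i).val : ℤ)) =
      ∑ v : Fin m → ZMod γ, f (K *ᵥ fun i => ((v i).val : ℤ)) := by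
  have hKγ : IsUnit (K.map (Int.cast : ℤ → ZMod γ)) :=
    ((isUnit_iff_isUnit_det K).2 hunit).map (Int.castRingHom (ZMod γ)).mapMatrix
  symm
  refine Fintype.sum_bijective (fun v => K.map (Int.cast : ℤ → ZMod γ) *ᵥ v)
    (mulVec_injective_of_isUnit hKγ).bijective_of_finite _ _ fun v => ?_
  have hdvd (i : Fin m) : (γ : ℤ) ∣ (((K.map (Int.cast : ℤ → ZMod γ) *ᵥ v) i).val : ℤ) -
      (K *ᵥ fun i => ((v i).val : ℤ)) i := by
    rw [← ZMod.intCast_eq_intCast_iff_dvd_sub]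
    simp [mulVec, dotProduct]
  choose x hx using hdvd
  rw [← hf _ x]
  congr 1
  funext i
  simp [← hx]

theorem sum_piFinset_range_eq {m γ : ℕ} [NeZero γ] (f : (Fin m → ℤ) → ℂ) :
    ∑ d ∈ Fintype.piFinset fun _ : Fin m => Finset.range γ, f (fun i => (d i : ℤ)) =
      ∑ v : Fin m → ZMod γ, f (fun i => ((v i).val : ℤ)) := by
  symm
  refine Finset.sum_bij (fun v _ i => (v i).val) (fun v _ => ?_) (fun v _ w _ h => ?_)
    (fun d hd => ?_) fun v _ => rfl
  · simp [ZMod.val_lt]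
  · exact funext fun i => ZMod.val_injective γ (congrFun h i)
  · refine ⟨fun i => (d i : ZMod γ), Finset.mem_univ _, funext fun i => ?_⟩
    rw [Fintype.mem_piFinset] at hd
    exact ZMod.val_cast_of_lt (Finset.mem_range.1 (hd i))

theorem gExt_condition_iff (n : ℕ) (S : Matrix (Fin n) (Fin n) ℤ) {γ : ℕ} (hγ : 0 < γ)
    (d : Fin (n + 2) → ℕ) :
    ((∃ e : ℤ, quadF ℚ (MatS0 n S) (fun j => (d j : ℚ)) = (γ : ℚ) * e) ∧
        ratGcd (((MatS1 n S).map (Int.cast : ℤ → ℚ)).mulVec (gExt n S d γ)) = 1) ↔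
      IsAdmissible (MatS0 n S) γ (fun i => (d i : ℤ)) := by
  have hγ' : (γ : ℚ) ≠ 0 := by exact_mod_cast hγ.ne'
  set v : Fin (n + 2) → ℤ := fun i => (d i : ℤ) with hv
  have hQ : quadF ℚ (MatS0 n S) (fun j => (d j : ℚ)) =
      ((v ⬝ᵥ MatS0 n S *ᵥ v : ℤ) : ℚ) / 2 := by
    rw [← quadF_intCast]
    simp [hv]
  have hQe (e : ℤ) : quadF ℚ (MatS0 n S) (fun j => (d j : ℚ)) = (γ : ℚ) * e ↔
      v ⬝ᵥ MatS0 n S *ᵥ v = 2 * γ * e := by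
    rw [hQ, div_eq_iff two_ne_zero, ← Int.cast_inj (α := ℚ)]
    push_cast
    rw [show (γ : ℚ) * e * 2 = 2 * γ * e by ring]
  rw [IsAdmissible, ← exists_and_right]
  refine exists_congr fun e => ?_
  rw [hQe]
  refine and_congr_right fun he => ?_
  have hg0 : gExt n S d γ 0 = ((-e : ℤ) : ℚ) := by
    simp only [gExt, Fin.val_zero, dite_true, (hQe e).2 he]
    push_cast
    field_simp
  have hgl : gExt n S d γ (Fin.last (n + 3)) = ((γ : ℤ) : ℚ) := by
    simp [gExt]
  have hgm : (fun j : Fin (n + 2) => gExt n S d γ j.succ.castSucc) = fun j => (v j : ℚ) := by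
    funext j
    have : (j : ℕ) ≠ n + 2 := j.isLt.ne
    simp [gExt, hv, this]
  have hw : (MatS1 n S).map (Int.cast : ℤ → ℚ) *ᵥ gExt n S d γ = fun i =>
      (((Fin.snoc (Fin.cons (γ : ℤ) (MatS0 n S *ᵥ v)) (-e) : Fin (n + 4) → ℤ) i : ℤ) : ℚ) := by
    refine funext (forall_fin_ends.2 ⟨?_, fun i => ?_, ?_⟩)
    · rw [MatS1, hyp_mulVec_zero, hgl]
      rfl
    · rw [MatS1, hyp_mulVec_mid, hgm, map_mulVec_intCast, Fin.snoc_castSucc, Fin.cons_succ]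
    · rw [MatS1, hyp_mulVec_last, hg0, Fin.snoc_last]
  rw [hw, ratGcd_intCast_eq_one]
  refine forall_congr' fun p => ?_
  rw [forall_fin_ends]
  simp only [Fin.snoc_castSucc, Fin.cons_succ, Fin.snoc_last, dvd_neg, and_imp]
  rfl

theorem aCoef_eq_sum_zmod (n : ℕ) (S : Matrix (Fin n) (Fin n) ℤ) (lam : Fin (n + 2) → ℚ)
    (γ : ℕ) [NeZero γ] :
    aCoef n S lam γ = ∑ v : Fin (n + 2) → ZMod γ,
      admissibleTerm (MatS0 n S) lam γ (fun i => ((v i).val : ℤ)) := by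
  rw [← sum_piFinset_range_eq (admissibleTerm (MatS0 n S) lam γ), aCoef]
  refine Finset.sum_congr rfl fun d _ => ?_
  simp only [admissibleTerm, Int.cast_natCast]
  classical
  exact if_congr (gExt_condition_iff n S (NeZero.pos γ) d) rfl rfl

end OEis

/-- invariance of the Dirichlet coefficients under integral
orthogonal transformations of `S₀`. -/
theorem dirichlet_coeff_orthogonal_invariant
    (n : ℕ) (hn : 1 ≤ n) (S : Matrix (Fin n) (Fin n) ℤ)
    (hsymm : S.IsSymm)
    (hpos : ∀ v : Fin n → ℝ, v ≠ 0 → 0 < bilin ℝ S v v)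
    (heven : ∀ v : Fin n → ℤ, 2 ∣ v ⬝ᵥ S.mulVec v)
    (lam : Fin (n + 2) → ℚ) (hlam : inDual (MatS0 n S) lam)
    (γ : ℕ) (hγ : 0 < γ)
    (K : Matrix (Fin (n + 2)) (Fin (n + 2)) ℤ)
    (hK : Kᵀ * MatS0 n S * K = MatS0 n S) :
    aCoef n S ((K.map (Int.cast : ℤ → ℚ)).mulVec lam) γ = aCoef n S lam γ := by
  have : NeZero γ := ⟨hγ.ne'⟩
  have hA : (MatS0 n S).IsSymm := hyp_isSymm _ hsymm.neg
  have hAeven : ∀ v : Fin (n + 2) → ℤ, 2 ∣ v ⬝ᵥ MatS0 n S *ᵥ v :=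
    hyp_even _ fun v => by simpa [neg_mulVec] using heven v
  have hdet : (MatS0 n S).det ≠ 0 :=
    hyp_det_ne_zero _ (by simpa [det_neg] using det_ne_zero_of_bilin_pos S hpos)
  have hunit := isUnit_det_of_transpose_mul_mul hdet hK
  rw [aCoef_eq_sum_zmod, aCoef_eq_sum_zmod, sum_val_mulVec hunit
    (admissibleTerm_add_smul hγ hA hAeven (inDual_mulVec hK hunit hlam))]
  exact Finset.sum_congr rfl fun v _ => admissibleTerm_mulVec hK hunit lam _
end

section
/- For every prime p and every λ ∈ L₀^# \ {0} there exists K ∈ O⁺(S₀;ℤ) such that Kλ = p^{ν_λ}·(l*, μ*, m*) for some (l*, μ*, m*) ∈ L₀^# with p ∤ m*, where ν_λ := ν_p(gcd(S₀λ)) and ν_p denotes the p-adic valuation. -/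
open Matrix Complex

open OEis

namespace OEis

section HypVec

variable {R : Type*} {n : ℕ}

/-- The vector `(l, μ, m)` of length `n + 2` over an arbitrary type. -/
def hypVec (l : R) (μ : Fin n → R) (m : R) : Fin (n + 2) → R := fun i =>
  if h0 : (i : ℕ) = 0 then l
  else if h1 : (i : ℕ) = n + 1 then m
  else μ ⟨(i : ℕ) - 1, by have := i.isLt; omega⟩

@[simp] lemma hypVec_zero (l : R) (μ : Fin n → R) (m : R) : hypVec l μ m 0 = l := by
  simp [hypVec]

@[simp] lemma hypVec_last (l : R) (μ : Fin n → R) (m : R) :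
    hypVec l μ m (Fin.last n).succ = m := by
  simp [hypVec]

@[simp] lemma hypVec_mid (l : R) (μ : Fin n → R) (m : R) (i : Fin n) :
    hypVec l μ m i.castSucc.succ = μ i := by
  have := i.isLt
  simp [hypVec, this.ne]

lemma forall_fin_hyp {P : Fin (n + 2) → Prop} :
    (∀ i, P i) ↔ P 0 ∧ (∀ i : Fin n, P i.castSucc.succ) ∧ P (Fin.last n).succ := by
  rw [Fin.forall_fin_succ, Fin.forall_fin_succ']

lemma eq_hypVec (x : Fin (n + 2) → R) :
    x = hypVec (x 0) (fun i => x i.castSucc.succ) (x (Fin.last n).succ) := by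
  rw [funext_iff, forall_fin_hyp]
  simp [-Fin.succ_last]

lemma map_hypVec {R' : Type*} (φ : R → R') (l : R) (μ : Fin n → R) (m : R) :
    (fun i => φ (hypVec l μ m i)) = hypVec (φ l) (fun i => φ (μ i)) (φ m) := by
  rw [funext_iff, forall_fin_hyp]
  simp [-Fin.succ_last]

lemma hypVec_add [Add R] (l l' : R) (μ μ' : Fin n → R) (m m' : R) :
    hypVec l μ m + hypVec l' μ' m' = hypVec (l + l') (μ + μ') (m + m') := by
  rw [funext_iff, forall_fin_hyp]
  simp [-Fin.succ_last]

lemma smul_hypVec [Mul R] (a l : R) (μ : Fin n → R) (m : R) :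
    a • hypVec l μ m = hypVec (a * l) (a • μ) (a * m) := by
  rw [funext_iff, forall_fin_hyp]
  simp [-Fin.succ_last]

lemma hypVec_dotProduct [CommRing R] (l l' : R) (μ μ' : Fin n → R) (m m' : R) :
    hypVec l μ m ⬝ᵥ hypVec l' μ' m' = l * l' + μ ⬝ᵥ μ' + m * m' := by
  simp only [dotProduct, Fin.sum_univ_succ (n := n + 1), Fin.sum_univ_castSucc (n := n),
    hypVec_zero, hypVec_last, hypVec_mid]
  ring

lemma MatS0_mulVec_hypVec [CommRing R] (S : Matrix (Fin n) (Fin n) ℤ)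
    (l : R) (μ : Fin n → R) (m : R) :
    (MatS0 n S).map (Int.cast : ℤ → R) *ᵥ hypVec l μ m
      = hypVec m (-(S.map (Int.cast : ℤ → R) *ᵥ μ)) l := by
  have hne (i : Fin n) : (i : ℕ) ≠ n := i.isLt.ne
  rw [funext_iff, forall_fin_hyp]
  simp [mulVec, dotProduct, Fin.sum_univ_succ (n := n + 1), Fin.sum_univ_castSucc (n := n),
    -Fin.succ_last, MatS0, hyp, hne]

lemma isSymm_MatS0 {S : Matrix (Fin n) (Fin n) ℤ} (hS : S.IsSymm) : (MatS0 n S).IsSymm := by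
  have hne (i : Fin n) : (i : ℕ) ≠ n := i.isLt.ne
  refine Matrix.IsSymm.ext ?_
  simp only [forall_fin_hyp]
  simp [MatS0, hyp, hne, -Fin.succ_last, hS.apply]

/-- The matrix of `x ↦ x + (f·x) e₀ + (g·x) (0, v, 0) + (h·x) e_{n+1}`. -/
def hypUpdate (v : Fin n → ℤ) (f g h : Fin (n + 2) → ℤ) : Matrix (Fin (n + 2)) (Fin (n + 2)) ℤ :=
  1 + vecMulVec (hypVec 1 0 0) f + vecMulVec (hypVec 0 v 0) g + vecMulVec (hypVec 0 0 1) h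

lemma hypUpdate_mulVec [CommRing R] (v : Fin n → ℤ) (f g h : Fin (n + 2) → ℤ)
    (l : R) (μ : Fin n → R) (m : R) :
    (hypUpdate v f g h).map (Int.cast : ℤ → R) *ᵥ hypVec l μ m
      = hypVec (l + (fun i => (f i : R)) ⬝ᵥ hypVec l μ m)
          (μ + ((fun i => (g i : R)) ⬝ᵥ hypVec l μ m) • fun i => (v i : R))
          (m + (fun i => (h i : R)) ⬝ᵥ hypVec l μ m) := by
  have key : (hypUpdate v f g h).map (Int.cast : ℤ → R)
      = 1 + vecMulVec (hypVec 1 0 0) (fun i => (f i : R))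
        + vecMulVec (hypVec 0 (fun i => (v i : R)) 0) (fun i => (g i : R))
        + vecMulVec (hypVec 0 0 1) (fun i => (h i : R)) := by
    ext i j
    revert i
    rw [forall_fin_hyp]
    simp [hypUpdate, vecMulVec_apply, Matrix.one_apply, -Fin.succ_last, apply_ite]
  rw [key]
  simp only [add_mulVec, one_mulVec, vecMulVec_mulVec, op_smul_eq_smul, smul_hypVec, hypVec_add]
  simp

end HypVec

section Reflection

variable {m : ℕ} {A : Matrix (Fin m) (Fin m) ℝ}

/-- The reflection along `w` with respect to the bilinear form `A`. -/
noncomputable def reflMat (A : Matrix (Fin m) (Fin m) ℝ) (w : Fin m → ℝ) :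
    Matrix (Fin m) (Fin m) ℝ :=
  1 - (2 / (w ⬝ᵥ A *ᵥ w)) • vecMulVec w (A *ᵥ w)

lemma reflMat_mulVec (A : Matrix (Fin m) (Fin m) ℝ) (w x : Fin m → ℝ) :
    reflMat A w *ᵥ x = x + (-(2 / (w ⬝ᵥ A *ᵥ w) * ((A *ᵥ w) ⬝ᵥ x))) • w := by
  rw [reflMat, sub_mulVec, one_mulVec, smul_mulVec, vecMulVec_mulVec, op_smul_eq_smul,
    smul_smul, neg_smul, sub_eq_add_neg]

lemma reflMat_mul_self {w : Fin m → ℝ} (hw : w ⬝ᵥ A *ᵥ w ≠ 0) :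
    reflMat A w * reflMat A w = 1 := by
  simp only [reflMat, sub_mul, mul_sub, one_mul, mul_one, smul_mul_assoc, mul_smul_comm,
    vecMulVec_mul_vecMulVec, dotProduct_comm (A *ᵥ w) w]
  ext i j
  simp [vecMulVec_apply]
  field_simp
  ring

lemma reflMat_orthogonal (hA : A.IsSymm) {w : Fin m → ℝ} (hw : w ⬝ᵥ A *ᵥ w ≠ 0) :
    (reflMat A w)ᵀ * A * reflMat A w = A := by
  have hwA : w ᵥ* A = A *ᵥ w := by rw [← mulVec_transpose, hA.eq]
  simp only [reflMat, transpose_sub, transpose_one, transpose_smul, transpose_vecMulVec,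
    sub_mul, mul_sub, one_mul, mul_one, smul_mul_assoc, mul_smul_comm, vecMulVec_mul,
    mul_vecMulVec, hwA, vecMulVec_mulVec, op_smul_eq_smul, dotProduct_comm (A *ᵥ w) w]
  ext i j
  simp [vecMulVec_apply]
  field_simp
  ring

lemma orthogonal_mul {M N : Matrix (Fin m) (Fin m) ℝ} (hM : Mᵀ * A * M = A)
    (hN : Nᵀ * A * N = A) : (M * N)ᵀ * A * (M * N) = A := by
  calc (M * N)ᵀ * A * (M * N) = Nᵀ * (Mᵀ * A * M) * N := by
        rw [transpose_mul]; simp only [Matrix.mul_assoc]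
    _ = A := by rw [hM, hN]

/-- Two reflections along negative vectors with non-positive inner product multiply to an element
of the identity component: move one vector to the other along a segment. -/
lemma reflMat_mul_reflMat_mem_OPlus {A : Matrix (Fin m) (Fin m) ℤ} (hA : A.IsSymm)
    {w₁ w₂ : Fin m → ℝ}
    (h₁ : w₁ ⬝ᵥ A.map (Int.cast : ℤ → ℝ) *ᵥ w₁ < 0) (h₂ : w₂ ⬝ᵥ A.map (Int.cast : ℤ → ℝ) *ᵥ w₂ < 0)
    (h₁₂ : w₁ ⬝ᵥ A.map (Int.cast : ℤ → ℝ) *ᵥ w₂ ≤ 0) :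
    reflMat (A.map Int.cast) w₁ * reflMat (A.map Int.cast) w₂ ∈ OPlus A := by
  set B : Matrix (Fin m) (Fin m) ℝ := A.map Int.cast with hB
  have hBs : B.IsSymm := hA.map _
  have h₂₁ : w₂ ⬝ᵥ B *ᵥ w₁ = w₁ ⬝ᵥ B *ᵥ w₂ := by
    rw [dotProduct_mulVec, ← mulVec_transpose, hBs.eq, dotProduct_comm]
  let w : ℝ → Fin m → ℝ := fun t => (1 - t) • w₂ + t • w₁
  have hw : Continuous w := by fun_prop
  have hneg : ∀ t ∈ Set.Icc (0 : ℝ) 1, w t ⬝ᵥ B *ᵥ w t < 0 := by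
    rintro t ⟨ht0, ht1⟩
    have e : w t ⬝ᵥ B *ᵥ w t = (1 - t) ^ 2 * (w₂ ⬝ᵥ B *ᵥ w₂)
        + 2 * (t * (1 - t)) * (w₁ ⬝ᵥ B *ᵥ w₂) + t ^ 2 * (w₁ ⬝ᵥ B *ᵥ w₁) := by
      simp only [w, mulVec_add, mulVec_smul, dotProduct_add, add_dotProduct, dotProduct_smul,
        smul_dotProduct, smul_eq_mul, h₂₁]
      ring
    have h3 : 2 * (t * (1 - t)) * (w₁ ⬝ᵥ B *ᵥ w₂) ≤ 0 :=
      mul_nonpos_of_nonneg_of_nonpos (by nlinarith) h₁₂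
    rcases ht0.eq_or_lt with rfl | ht
    · rw [e]; simpa using h₂
    · have h4 : t ^ 2 * (w₁ ⬝ᵥ B *ᵥ w₁) < 0 := mul_neg_of_pos_of_neg (by positivity) h₁
      have h5 : (1 - t) ^ 2 * (w₂ ⬝ᵥ B *ᵥ w₂) ≤ 0 :=
        mul_nonpos_of_nonneg_of_nonpos (by positivity) h₂.le
      linarith
  have hcont : ContinuousOn (fun t => reflMat B (w t) * reflMat B w₂) (Set.Icc 0 1) := by
    have hd : Continuous fun t => w t ⬝ᵥ B *ᵥ w t := by fun_prop
    have hv : Continuous fun t => vecMulVec (w t) (B *ᵥ w t) := by fun_prop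
    refine ContinuousOn.mul ?_ continuousOn_const
    unfold reflMat
    exact continuousOn_const.sub
      ((continuousOn_const.div hd.continuousOn fun t ht => (hneg t ht).ne).smul hv.continuousOn)
  have hpre := isPreconnected_Icc.image _ hcont
  refine hpre.subset_connectedComponentIn ⟨0, by simp, ?_⟩ ?_ ⟨1, by simp, by simp [w]⟩
  · simpa [w] using reflMat_mul_self h₂.ne
  · rintro _ ⟨t, ht, rfl⟩
    exact orthogonal_mul (reflMat_orthogonal hBs (hneg t ht).ne) (reflMat_orthogonal hBs h₂.ne)

end Reflection

section Lattice

variable {n : ℕ} {S : Matrix (Fin n) (Fin n) ℤ}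

/-- `K` is an integral point of the identity component of the orthogonal group of `S₀`. -/
def IsIntegralOPlus (S : Matrix (Fin n) (Fin n) ℤ) (K : Matrix (Fin (n + 2)) (Fin (n + 2)) ℤ) :
    Prop :=
  Kᵀ * MatS0 n S * K = MatS0 n S ∧ K.map (Int.cast : ℤ → ℝ) ∈ OPlus (MatS0 n S)

lemma orthogonal_of_mem_OPlus {m : ℕ} {A K : Matrix (Fin m) (Fin m) ℤ}
    (hK : K.map (Int.cast : ℤ → ℝ) ∈ OPlus A) : Kᵀ * A * K = A := by
  have h : (K.map (Int.cast : ℤ → ℝ))ᵀ * A.map Int.cast * K.map Int.cast = A.map Int.cast :=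
    connectedComponentIn_subset (OSet A) 1 hK
  apply Matrix.map_injective (f := (Int.cast : ℤ → ℝ)) Int.cast_injective
  have hm (X Y : Matrix (Fin m) (Fin m) ℤ) :
      (X * Y).map (Int.cast : ℤ → ℝ) = X.map Int.cast * Y.map Int.cast :=
    Matrix.map_mul (f := Int.castRingHom ℝ)
  change (Kᵀ * A * K).map _ = A.map _
  rw [hm, hm, transpose_map, h]

lemma isIntegralOPlus_one : IsIntegralOPlus S 1 := by
  have h1 : (1 : Matrix (Fin (n + 2)) (Fin (n + 2)) ℤ).map (Int.cast : ℤ → ℝ) = 1 :=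
    Matrix.map_one _ Int.cast_zero Int.cast_one
  refine ⟨by simp, ?_⟩
  rw [h1]
  exact mem_connectedComponentIn (by simp [OSet])

lemma isIntegralOPlus_of_mulVec (hS : S.IsSymm) {K : Matrix (Fin (n + 2)) (Fin (n + 2)) ℤ}
    {w₁ w₂ : Fin (n + 2) → ℝ}
    (h₁ : w₁ ⬝ᵥ (MatS0 n S).map (Int.cast : ℤ → ℝ) *ᵥ w₁ < 0)
    (h₂ : w₂ ⬝ᵥ (MatS0 n S).map (Int.cast : ℤ → ℝ) *ᵥ w₂ < 0)
    (h₁₂ : w₁ ⬝ᵥ (MatS0 n S).map (Int.cast : ℤ → ℝ) *ᵥ w₂ ≤ 0)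
    (hK : ∀ (l : ℝ) (μ : Fin n → ℝ) (m : ℝ), K.map (Int.cast : ℤ → ℝ) *ᵥ hypVec l μ m
      = reflMat ((MatS0 n S).map Int.cast) w₁ *ᵥ
          (reflMat ((MatS0 n S).map Int.cast) w₂ *ᵥ hypVec l μ m)) :
    IsIntegralOPlus S K := by
  have hmem : K.map (Int.cast : ℤ → ℝ) ∈ OPlus (MatS0 n S) := by
    have e : K.map (Int.cast : ℤ → ℝ)
        = reflMat ((MatS0 n S).map Int.cast) w₁ * reflMat ((MatS0 n S).map Int.cast) w₂ := by
      apply Matrix.mulVec_injective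
      funext x
      rw [eq_hypVec x, hK, mulVec_mulVec]
    rw [e]
    exact reflMat_mul_reflMat_mem_OPlus (isSymm_MatS0 hS) h₁ h₂ h₁₂
  exact ⟨orthogonal_of_mem_OPlus hmem, hmem⟩

lemma cast_mulVec {R : Type*} [CommRing R] (v : Fin n → ℤ) :
    S.map (Int.cast : ℤ → R) *ᵥ (fun i => (v i : R)) = fun i => ((S *ᵥ v) i : R) := by
  ext i
  simp [mulVec, dotProduct]

lemma cast_dotProduct {R : Type*} [CommRing R] (u v : Fin n → ℤ) :
    (fun i => (u i : R)) ⬝ᵥ (fun i => (v i : R)) = ((u ⬝ᵥ v : ℤ) : R) := by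
  simp [dotProduct]

/-- The Eichler transformation
`(l, μ, m) ↦ (l, μ + l u, m + uᵀSμ + q l)`, where `q = uᵀSu / 2`. -/
def eichler (S : Matrix (Fin n) (Fin n) ℤ) (u : Fin n → ℤ) (q : ℤ) :
    Matrix (Fin (n + 2)) (Fin (n + 2)) ℤ :=
  hypUpdate u 0 (hypVec 1 0 0) (hypVec q (S *ᵥ u) 0)

lemma eichler_mulVec {R : Type*} [CommRing R] (u : Fin n → ℤ) (q : ℤ)
    (l : R) (μ : Fin n → R) (m : R) :
    (eichler S u q).map (Int.cast : ℤ → R) *ᵥ hypVec l μ m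
      = hypVec l (μ + l • fun i => (u i : R))
          (m + (q * l + (fun i => ((S *ᵥ u) i : R)) ⬝ᵥ μ)) := by
  have hz : (fun i : Fin n => (((0 : Fin n → ℤ) i : ℤ) : R)) = 0 := by ext; simp
  have hz' : (fun i : Fin (n + 2) => (((0 : Fin (n + 2) → ℤ) i : ℤ) : R)) = 0 := by ext; simp
  rw [eichler, hypUpdate_mulVec]
  simp only [map_hypVec, hypVec_dotProduct, hz, hz', zero_dotProduct]
  simp

lemma isIntegralOPlus_eichler (hS : S.IsSymm) {u : Fin n → ℤ} {q : ℤ}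
    (hu : u ⬝ᵥ S *ᵥ u = 2 * q) (hq : 0 < q) : IsIntegralOPlus S (eichler S u q) := by
  have hq' : (0 : ℝ) < q := by exact_mod_cast hq
  have huR : (fun i => (u i : ℝ)) ⬝ᵥ (fun i => ((S *ᵥ u) i : ℝ)) = 2 * q := by
    rw [cast_dotProduct, hu]; push_cast; rfl
  have huR' : (fun i => ((S *ᵥ u) i : ℝ)) ⬝ᵥ (fun i => (u i : ℝ)) = 2 * q := by
    rw [dotProduct_comm, huR]
  refine isIntegralOPlus_of_mulVec hS (w₁ := hypVec 0 (fun i => (u i : ℝ)) q)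
    (w₂ := hypVec 0 (fun i => (u i : ℝ)) 0) ?_ ?_ ?_ ?_
  iterate 3
    simp only [MatS0_mulVec_hypVec, cast_mulVec, hypVec_dotProduct, dotProduct_neg, huR]
    linarith
  intro l μ m
  simp only [eichler_mulVec, reflMat_mulVec, MatS0_mulVec_hypVec, cast_mulVec,
    hypVec_dotProduct, dotProduct_neg, neg_dotProduct, huR, smul_hypVec, hypVec_add,
    dotProduct_add, dotProduct_smul, huR', smul_eq_mul]
  congr 1
  · simp
  · rw [add_assoc, ← add_smul]
    congr 2
    field_simp
    ring
  · field_simp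
    ring

/-- The Atkin–Lehner type element attached to `v` with `Sv = N y`, `vᵀSv = 2 N c'` and
`c c' = 1 + N a`. -/
def atkinLehner (N c c' a : ℤ) (v y : Fin n → ℤ) : Matrix (Fin (n + 2)) (Fin (n + 2)) ℤ :=
  hypUpdate v (hypVec (N - 1) (-N • y) c') (hypVec c (-c • y) a)
    (hypVec (c ^ 2 * c') (-(a * c * N) • y) (N * a ^ 2 - 1))

lemma atkinLehner_mulVec {R : Type*} [CommRing R] (N c c' a : ℤ) (v y : Fin n → ℤ)
    (l : R) (μ : Fin n → R) (m : R) :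
    (atkinLehner N c c' a v y).map (Int.cast : ℤ → R) *ᵥ hypVec l μ m
      = hypVec (N * l + c' * m - N * ((fun i => (y i : R)) ⬝ᵥ μ))
          (μ + (c * l + a * m - c * ((fun i => (y i : R)) ⬝ᵥ μ)) • fun i => (v i : R))
          (c ^ 2 * c' * l + N * a ^ 2 * m - a * c * N * ((fun i => (y i : R)) ⬝ᵥ μ)) := by
  have hz (k : ℤ) : (fun i : Fin n => (((k • y) i : ℤ) : R))
      = (k : R) • fun i => (y i : R) := by ext; simp
  rw [atkinLehner, hypUpdate_mulVec]
  simp only [map_hypVec, hypVec_dotProduct, hz, smul_dotProduct, smul_eq_mul]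
  push_cast
  congr 1
  · ring
  · congr 2
    ring
  · ring

lemma isIntegralOPlus_atkinLehner (hS : S.IsSymm) {N c c' a : ℤ} {v y : Fin n → ℤ}
    (hN : 0 < N) (hc : 0 < c) (ha : 1 ≤ a) (hca : c * c' = 1 + N * a)
    (hy : S *ᵥ v = N • y) (hv : v ⬝ᵥ S *ᵥ v = 2 * N * c') :
    IsIntegralOPlus S (atkinLehner N c c' a v y) := by
  have hN' : (0 : ℝ) < N := by exact_mod_cast hN
  have hc' : (0 : ℝ) < c := by exact_mod_cast hc
  have ha' : (1 : ℝ) ≤ a := by exact_mod_cast ha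
  have hca' : (c : ℝ) * c' = 1 + N * a := by exact_mod_cast hca
  have hvy : v ⬝ᵥ y = 2 * c' := by
    have : N * (v ⬝ᵥ y) = N * (2 * c') := by
      rw [hy, dotProduct_smul, smul_eq_mul] at hv; linarith
    exact mul_left_cancel₀ hN.ne' this
  have hvR : (fun i => (v i : ℝ)) ⬝ᵥ (fun i => (y i : ℝ)) = 2 * c' := by
    rw [cast_dotProduct, hvy]; push_cast; rfl
  have hyR : S.map (Int.cast : ℤ → ℝ) *ᵥ (fun i => (v i : ℝ))
      = (N : ℝ) • fun i => (y i : ℝ) := by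
    rw [cast_mulVec, hy]; ext; simp
  have hc'' : (c' : ℝ) = (1 + N * a) / c := by field_simp; linarith
  refine isIntegralOPlus_of_mulVec hS (w₁ := hypVec 1 0 (-c))
    (w₂ := hypVec (N * a) ((c : ℝ) • fun i => (v i : ℝ)) (c * N)) ?_ ?_ ?_ ?_
  · simp only [MatS0_mulVec_hypVec, hypVec_dotProduct, mulVec_zero, neg_zero, dotProduct_zero]
    linarith
  · simp only [MatS0_mulVec_hypVec, hypVec_dotProduct, mulVec_smul, hyR, dotProduct_neg,
      dotProduct_smul, smul_dotProduct, smul_eq_mul, hvR]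
    have : 0 < (c : ℝ) * N := by positivity
    have e : (c : ℝ) * (c * (N * (2 * c'))) = 2 * (c * N) * (1 + N * a) := by
      rw [← hca']; ring
    nlinarith
  · simp only [MatS0_mulVec_hypVec, hypVec_dotProduct, zero_dotProduct]
    have : 0 < (c : ℝ) * N := by positivity
    nlinarith
  intro l μ m
  simp only [atkinLehner_mulVec, reflMat_mulVec, MatS0_mulVec_hypVec, hypVec_dotProduct,
    mulVec_smul, hyR, dotProduct_neg, neg_dotProduct, smul_hypVec, hypVec_add, mulVec_zero,
    dotProduct_add, dotProduct_smul, smul_dotProduct, hvR, smul_eq_mul, zero_dotProduct,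
    neg_zero, dotProduct_zero, smul_zero, add_zero]
  generalize (fun i => (y i : ℝ)) ⬝ᵥ μ = Y
  have h1 : (1 : ℝ) * -c + -c * 1 = -(2 * c) := by ring
  rw [h1, hc'']
  congr 1
  · field_simp
    ring
  · rw [smul_smul]
    congr 2
    field_simp
    ring
  · field_simp
    ring

/-- An even positive definite lattice has a vector whose reflection is integral at `p`. -/
lemma exists_reflective_vector (hn : 1 ≤ n) (hsymm : S.IsSymm)
    (hpos : ∀ v : Fin n → ℤ, v ≠ 0 → 0 < v ⬝ᵥ S *ᵥ v)
    (heven : ∀ v : Fin n → ℤ, 2 ∣ v ⬝ᵥ S *ᵥ v) {p : ℕ} (hp : p.Prime) :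
    ∃ (k : ℕ) (c' : ℤ) (v y : Fin n → ℤ), 0 < c' ∧ ¬ (p : ℤ) ∣ c' ∧
      S *ᵥ v = (p : ℤ) ^ k • y ∧ v ⬝ᵥ S *ᵥ v = 2 * (p : ℤ) ^ k * c' := by
  have hppos : (0 : ℤ) < p := by exact_mod_cast hp.pos
  have hex : ∃ k : ℕ, ¬ ∀ u : Fin n → ℤ, 2 * (p : ℤ) ^ (k + 1) ∣ u ⬝ᵥ S *ᵥ u := by
    let u : Fin n → ℤ := Pi.single ⟨0, hn⟩ 1
    have hu : 0 < u ⬝ᵥ S *ᵥ u := hpos u (by simp [u])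
    refine ⟨(u ⬝ᵥ S *ᵥ u).toNat, fun h => ?_⟩
    have h1 := Int.le_of_dvd hu (h u)
    have h2 : (u ⬝ᵥ S *ᵥ u).toNat < p ^ (u ⬝ᵥ S *ᵥ u).toNat := Nat.lt_pow_self hp.one_lt
    have h3 : ((u ⬝ᵥ S *ᵥ u).toNat : ℤ) < (p : ℤ) ^ (u ⬝ᵥ S *ᵥ u).toNat := by exact_mod_cast h2
    have h4 : (1 : ℤ) < p := by exact_mod_cast hp.one_lt
    rw [Int.toNat_of_nonneg hu.le] at h3
    rw [pow_succ] at h1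
    nlinarith
  classical
  obtain ⟨k, hk, hall⟩ : ∃ k : ℕ, (¬ ∀ u : Fin n → ℤ, 2 * (p : ℤ) ^ (k + 1) ∣ u ⬝ᵥ S *ᵥ u) ∧
      ∀ u : Fin n → ℤ, 2 * (p : ℤ) ^ k ∣ u ⬝ᵥ S *ᵥ u := by
    refine ⟨Nat.find hex, Nat.find_spec hex, ?_⟩
    rcases h : Nat.find hex with _ | k
    · simpa using heven
    · exact not_not.1 (Nat.find_min hex (m := k) (by omega))
  push Not at hk
  obtain ⟨v, hv⟩ := hk
  obtain ⟨c', hc'⟩ := hall v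
  have hy (i : Fin n) : ∃ t, (S *ᵥ v) i = (p : ℤ) ^ k * t := by
    have e : (v + Pi.single i 1) ⬝ᵥ S *ᵥ (v + Pi.single i 1)
        = v ⬝ᵥ S *ᵥ v + 2 * (S *ᵥ v) i + Pi.single i 1 ⬝ᵥ S *ᵥ Pi.single i 1 := by
      have : v ⬝ᵥ S *ᵥ Pi.single i 1 = (S *ᵥ v) i := by
        rw [dotProduct_mulVec, ← mulVec_transpose, hsymm.eq, dotProduct_single_one]
      rw [mulVec_add, add_dotProduct, dotProduct_add, dotProduct_add, this,
        single_one_dotProduct]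
      ring
    obtain ⟨a, ha⟩ := hall (v + Pi.single i 1)
    obtain ⟨b, hb⟩ := hall (Pi.single i 1)
    refine ⟨a - c' - b, ?_⟩
    rw [ha, hc', hb] at e
    linarith
  choose y hy using hy
  have hc0 : 2 * (p : ℤ) ^ (k + 1) ∣ v ⬝ᵥ S *ᵥ v → False := hv
  refine ⟨k, c', v, y, ?_, ?_, funext fun i => by simp [hy], hc'⟩
  · have hv0 : v ≠ 0 := by
      rintro rfl
      simp at hc0
    have := hpos v hv0
    rw [hc'] at this
    exact pos_of_mul_pos_right this (by positivity)
  · rintro ⟨t, rfl⟩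
    exact hc0 ⟨t, by rw [hc']; ring⟩

lemma exists_inverse_mod_of_not_dvd {p : ℕ} (hp : p.Prime) {c' : ℤ} (hc' : 0 < c')
    (h : ¬ (p : ℤ) ∣ c') (k : ℕ) :
    ∃ c d : ℤ, 0 < c ∧ 1 ≤ d ∧ c * c' = 1 + (p : ℤ) ^ k * (p * d) := by
  have hcop : IsCoprime ((p : ℤ) ^ (k + 1)) c' :=
    IsCoprime.pow_left (((Nat.prime_iff_prime_int.1 hp).irreducible.coprime_iff_not_dvd).2 h)
  obtain ⟨a, b, hab⟩ := hcop
  have hP : (0 : ℤ) < (p : ℤ) ^ (k + 1) := by have := hp.pos; positivity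
  have e (t : ℤ) : (b + t * (p : ℤ) ^ (k + 1)) * c'
      = 1 + (p : ℤ) ^ k * (p * (t * c' - a)) := by
    rw [pow_succ] at hab ⊢
    linear_combination hab
  refine ⟨_, _, ?_, ?_, e (|a| + |b| + 1)⟩
  · nlinarith [abs_nonneg a, abs_nonneg b, neg_abs_le b]
  · nlinarith [abs_nonneg a, abs_nonneg b, le_abs_self a]

lemma exists_isIntegralOPlus_not_dvd_last (hn : 1 ≤ n) (hsymm : S.IsSymm)
    (hpos : ∀ v : Fin n → ℤ, v ≠ 0 → 0 < v ⬝ᵥ S *ᵥ v)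
    (heven : ∀ v : Fin n → ℤ, 2 ∣ v ⬝ᵥ S *ᵥ v) {p : ℕ} (hp : p.Prime)
    (l m : ℤ) (μ : Fin n → ℚ) (s : Fin n → ℤ)
    (hs : S.map (Int.cast : ℤ → ℚ) *ᵥ μ = fun i => (s i : ℚ))
    (hndvd : ¬ ((p : ℤ) ∣ l ∧ (p : ℤ) ∣ m ∧ ∀ i, (p : ℤ) ∣ s i)) :
    ∃ K, IsIntegralOPlus S K ∧ ∃ (l' : ℤ) (μ' : Fin n → ℚ) (m' : ℤ),
      inDual S μ' ∧ ¬ (p : ℤ) ∣ m' ∧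
      K.map (Int.cast : ℤ → ℚ) *ᵥ hypVec (l : ℚ) μ m = hypVec (l' : ℚ) μ' m' := by
  have hpZ : Prime (p : ℤ) := Nat.prime_iff_prime_int.1 hp
  have hdual (u : Fin n → ℤ) : (fun i => ((S *ᵥ u) i : ℚ)) ⬝ᵥ μ = ((u ⬝ᵥ s : ℤ) : ℚ) := by
    rw [← cast_mulVec, dotProduct_comm, dotProduct_mulVec, ← mulVec_transpose,
      (hsymm.map _).eq, hs, cast_dotProduct, dotProduct_comm]
  by_cases hm : (p : ℤ) ∣ m
  swap
  · refine ⟨1, isIntegralOPlus_one, l, μ, m, fun i => ⟨s i, congrFun hs i⟩, hm, ?_⟩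
    rw [Matrix.map_one _ Int.cast_zero Int.cast_one, one_mulVec]
  by_cases hl : (p : ℤ) ∣ l
  · obtain ⟨i, hi⟩ : ∃ i, ¬ (p : ℤ) ∣ s i := by
      by_contra! h
      exact hndvd ⟨hl, hm, h⟩
    obtain ⟨q, hq⟩ := heven (Pi.single i 1)
    have hq0 : 0 < q := by
      have := hpos (Pi.single i 1) (by simp)
      omega
    refine ⟨_, isIntegralOPlus_eichler hsymm hq hq0, l,
      μ + (l : ℚ) • (fun j => ((Pi.single i 1 : Fin n → ℤ) j : ℚ)), m + (q * l + s i), ?_, ?_, ?_⟩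
    · intro j
      refine ⟨s j + l * (S *ᵥ Pi.single i 1) j, ?_⟩
      rw [mulVec_add, mulVec_smul, hs, cast_mulVec]
      simp
    · rwa [Int.dvd_add_right hm, Int.dvd_add_right (hl.mul_left q)]
    · rw [eichler_mulVec, hdual, single_one_dotProduct]
      push_cast
      rfl
  · obtain ⟨k, c', v, y, hcpos, hc', hy, hv⟩ := exists_reflective_vector hn hsymm hpos heven hp
    obtain ⟨c, d, hc, hd, hcd⟩ := exists_inverse_mod_of_not_dvd hp hcpos hc' k
    have hp0 : (0 : ℤ) < p := by exact_mod_cast hp.pos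
    have hNy : ((p ^ k : ℤ) : ℚ) * ((fun i => (y i : ℚ)) ⬝ᵥ μ) = ((v ⬝ᵥ s : ℤ) : ℚ) := by
      rw [← hdual, hy, ← smul_eq_mul, ← smul_dotProduct]
      congr 1
      ext i
      simp
    have hK : IsIntegralOPlus S (atkinLehner (p ^ k) c c' (p * d) v y) :=
      isIntegralOPlus_atkinLehner hsymm (by positivity) hc (by nlinarith) hcd hy hv
    refine ⟨_, hK, p ^ k * l + c' * m - v ⬝ᵥ s,
      μ + ((c : ℚ) * l + ((p * d : ℤ) : ℚ) * m - c * ((fun i => (y i : ℚ)) ⬝ᵥ μ)) •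
        fun i => (v i : ℚ),
      c ^ 2 * c' * l + p ^ k * (p * d) ^ 2 * m - (p * d) * c * (v ⬝ᵥ s), ?_, ?_, ?_⟩
    · intro j
      refine ⟨s j + (p ^ k * (c * l + (p * d) * m) - c * (v ⬝ᵥ s)) * y j, ?_⟩
      rw [mulVec_add, mulVec_smul, hs, cast_mulVec, hy]
      simp only [Pi.add_apply, Pi.smul_apply, smul_eq_mul]
      push_cast at hNy ⊢
      rw [← hNy]
      ring
    · intro h
      have h1 : (p : ℤ) ∣ c ^ 2 * c' * l := by
        have h2 : (p : ℤ) ∣ p ^ k * (p * d) ^ 2 * m := hm.mul_left _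
        have h3 : (p : ℤ) ∣ (p * d) * c * (v ⬝ᵥ s) := ⟨d * c * (v ⬝ᵥ s), by ring⟩
        simpa using dvd_sub (dvd_add h h3) h2
      have hpc : ¬ (p : ℤ) ∣ c := fun h2 => by
        have h3 : (p : ℤ) ∣ c * c' := h2.mul_right c'
        rw [hcd, Int.dvd_add_left ⟨p ^ k * d, by ring⟩] at h3
        exact hpZ.not_dvd_one h3
      rcases hpZ.dvd_or_dvd h1 with h2 | h2
      · rcases hpZ.dvd_or_dvd h2 with h3 | h3
        · exact hpc (hpZ.dvd_of_dvd_pow h3)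
        · exact hc' h3
      · exact hl h2
    · rw [atkinLehner_mulVec]
      congr 1
      · rw [hNy]; push_cast; rfl
      · push_cast at hNy ⊢
        linear_combination (-(p * d * c) : ℚ) * hNy

lemma hypVec_eq_zero_of_MatS0_mulVec_eq_zero
    (hpos : ∀ v : Fin n → ℝ, v ≠ 0 → 0 < bilin ℝ S v v) {L M : ℚ} {μ : Fin n → ℚ}
    (h : (MatS0 n S).map (Int.cast : ℤ → ℚ) *ᵥ hypVec L μ M = 0) : hypVec L μ M = 0 := by
  rw [MatS0_mulVec_hypVec, funext_iff, forall_fin_hyp] at h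
  simp only [hypVec_zero, hypVec_mid, hypVec_last, Pi.zero_apply, Pi.neg_apply,
    neg_eq_zero] at h
  obtain ⟨hM, hμ, hL⟩ := h
  have hμR : (fun i => (μ i : ℝ)) = 0 := by
    by_contra hne
    refine (hpos _ hne).ne' ?_
    have e : S.map (Int.cast : ℤ → ℝ) *ᵥ (fun i => (μ i : ℝ)) = 0 := by
      ext i
      have h1 : (((S.map (Int.cast : ℤ → ℚ) *ᵥ μ) i : ℚ) : ℝ) = 0 := by rw [hμ i]; simp
      simpa [mulVec, dotProduct] using h1
    rw [bilin, e, dotProduct_zero]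
  rw [funext_iff, forall_fin_hyp]
  have hμ' (i : Fin n) : μ i = 0 := by simpa using congrFun hμR i
  simp [hM, hL, hμ', -Fin.succ_last]

end Lattice

end OEis

/-- any `0 ≠ λ ∈ L₀^#` can be moved by some `K ∈ O⁺(S₀;ℤ)` to
`p^{ν_λ}·(l*,μ*,m*)` with `p ∤ m*`, where `ν_λ = ν_p(gcd(S₀λ))`. -/
theorem exists_orthogonal_normalizing_last_component
    (n : ℕ) (hn : 1 ≤ n) (S : Matrix (Fin n) (Fin n) ℤ)
    (hsymm : S.IsSymm)
    (hpos : ∀ v : Fin n → ℝ, v ≠ 0 → 0 < bilin ℝ S v v)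
    (heven : ∀ v : Fin n → ℤ, 2 ∣ v ⬝ᵥ S.mulVec v)
    (p : ℕ) (hp : p.Prime)
    (lam : Fin (n + 2) → ℚ) (hlam : inDual (MatS0 n S) lam) (hne : lam ≠ 0) :
    ∃ K : Matrix (Fin (n + 2)) (Fin (n + 2)) ℤ,
      Kᵀ * MatS0 n S * K = MatS0 n S ∧
      (K.map (Int.cast : ℤ → ℝ)) ∈ OPlus (MatS0 n S) ∧
      ∃ (lstar : ℤ) (mustar : Fin n → ℚ) (mstar : ℤ),
        inDual S mustar ∧ ¬ (p : ℤ) ∣ mstar ∧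
        (K.map (Int.cast : ℤ → ℚ)).mulVec lam
          = fun i =>
              (p : ℚ) ^ (padicValNat p
                  (ratGcd (((MatS0 n S).map (Int.cast : ℤ → ℚ)).mulVec lam))) *
                asmVec n (lstar : ℚ) mustar (mstar : ℚ) i := by
  have := Fact.mk hp
  have hposZ (v : Fin n → ℤ) (hv : v ≠ 0) : 0 < v ⬝ᵥ S *ᵥ v := by
    have h := hpos (fun i => (v i : ℝ)) fun h0 => hv (funext fun i => by
      simpa using congrFun h0 i)
    rw [bilin, cast_mulVec, cast_dotProduct] at h
    exact_mod_cast h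
  obtain ⟨L, μ, M, rfl⟩ : ∃ L μ M, lam = hypVec L μ M := ⟨_, _, _, eq_hypVec lam⟩
  choose z hz using hlam
  set V := (MatS0 n S).map (Int.cast : ℤ → ℚ) *ᵥ hypVec L μ M with hV
  have hgcd : ratGcd V = Finset.univ.gcd fun i => (z i).natAbs := by
    simp [ratGcd, hz]
  have hg0 : ratGcd V ≠ 0 := by
    intro h0
    rw [hgcd, Finset.gcd_eq_zero_iff] at h0
    have hV0 (i : Fin (n + 2)) : V i = 0 := by simpa [hz] using h0 i (Finset.mem_univ i)
    exact hne (hypVec_eq_zero_of_MatS0_mulVec_eq_zero hpos (funext hV0))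
  set ν := padicValNat p (ratGcd V) with hν
  have hdvd (i : Fin (n + 2)) : (p : ℤ) ^ ν ∣ z i := by
    have h1 : p ^ ν ∣ Finset.univ.gcd fun i => (z i).natAbs := hgcd ▸ pow_padicValNat_dvd
    have h2 := h1.trans (Finset.gcd_dvd (Finset.mem_univ i))
    exact_mod_cast Int.natCast_dvd.2 h2
  choose w hw using hdvd
  have hndvd : ¬ ∀ i, (p : ℤ) ∣ w i := fun h => by
    refine pow_succ_padicValNat_not_dvd (p := p) hg0 ?_
    rw [← hν, hgcd]
    refine Finset.dvd_gcd fun i _ => Int.natCast_dvd.1 ?_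
    rw [hw i]
    push_cast
    rw [pow_succ]
    exact mul_dvd_mul_left _ (h i)
  have hP : ((p : ℚ) ^ ν) ≠ 0 := pow_ne_zero _ (by exact_mod_cast hp.ne_zero)
  have hVw (i : Fin (n + 2)) : V i = (p : ℚ) ^ ν * w i := by
    rw [hz, hw]; push_cast; rfl
  rw [MatS0_mulVec_hypVec] at hV
  have hM : M = (p : ℚ) ^ ν * w 0 := by rw [← hVw, hV, hypVec_zero]
  have hL : L = (p : ℚ) ^ ν * w (Fin.last n).succ := by rw [← hVw, hV, hypVec_last]
  have hs : S.map (Int.cast : ℤ → ℚ) *ᵥ (((p : ℚ) ^ ν)⁻¹ • μ)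
      = fun i => ((-w i.castSucc.succ : ℤ) : ℚ) := by
    funext i
    have h1 := hVw i.castSucc.succ
    rw [hV, hypVec_mid, Pi.neg_apply] at h1
    rw [mulVec_smul, Pi.smul_apply, smul_eq_mul, neg_eq_iff_eq_neg.1 h1]
    push_cast
    field_simp
  obtain ⟨K, ⟨hK, hK'⟩, l', μ', m', hμ', hm', e⟩ :=
    exists_isIntegralOPlus_not_dvd_last hn hsymm hposZ heven hp (w (Fin.last n).succ) (w 0) _ _ hs
      fun ⟨h1, h2, h3⟩ => hndvd (forall_fin_hyp.2 ⟨h2, fun i => (dvd_neg).1 (h3 i), h1⟩)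
  refine ⟨K, hK, hK', l', μ', m', hμ', hm', ?_⟩
  have hlam : hypVec L μ M = (p : ℚ) ^ ν •
      hypVec (w (Fin.last n).succ : ℚ) (((p : ℚ) ^ ν)⁻¹ • μ) (w 0 : ℚ) := by
    rw [smul_hypVec, smul_inv_smul₀ hP, hL, hM]
  rw [hlam, mulVec_smul, e]
  rfl
end

section
/- Let p be a prime such that S is p-maximal, let λ ∈ L₀^# and ν ≥ 0 an integer. Then b(λ, p^ν) = Σ_{v ∈ (ℤ/p^νℤ)^{n+2}, Q₀(v) ≡ 0 (mod p^ν)} exp(2πi(λ,v)₀/p^ν), where the summand is independent of the chosen representative v since λ ∈ L₀^#. -/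
open Matrix Complex

open OEis

namespace OEis

section Hyperbolic

variable {m : ℕ}

lemma hyp_zero (A : Matrix (Fin m) (Fin m) ℤ) (j : Fin (m + 2)) :
    hyp A 0 j = if (j : ℕ) = m + 1 then 1 else 0 := by
  simp [hyp]

lemma hyp_last (A : Matrix (Fin m) (Fin m) ℤ) (j : Fin (m + 2)) :
    hyp A (Fin.last (m + 1)) j = if (j : ℕ) = 0 then 1 else 0 := by
  simp [hyp]

lemma hyp_mid (A : Matrix (Fin m) (Fin m) ℤ) (i j : Fin m) :
    hyp A i.castSucc.succ j.castSucc.succ = A i j := by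
  have hi := i.isLt.ne
  have hj := j.isLt.ne
  simp [hyp, hi, hj]

lemma hyp_mid_zero (A : Matrix (Fin m) (Fin m) ℤ) (i : Fin m) :
    hyp A i.castSucc.succ 0 = 0 := by
  have hi := i.isLt.ne
  simp [hyp, hi]

lemma hyp_mid_last (A : Matrix (Fin m) (Fin m) ℤ) (i : Fin m) :
    hyp A i.castSucc.succ (Fin.last m).succ = 0 := by
  have hi := i.isLt.ne
  simp [hyp, hi]

lemma hyp_mulVec_zero_s10 (A : Matrix (Fin m) (Fin m) ℤ) (v : Fin (m + 2) → ℚ) :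
    (((hyp A).map (Int.cast : ℤ → ℚ)).mulVec v) 0 = vlast v := by
  rw [Matrix.mulVec, dotProduct, Finset.sum_eq_single (Fin.last (m + 1))]
  · simp [hyp_zero, vlast, Fin.last]
  · intro j _ hj
    have : (j : ℕ) ≠ m + 1 := fun h => hj (Fin.ext h)
    simp [hyp_zero, this]
  · simp

lemma hyp_mulVec_last_s10 (A : Matrix (Fin m) (Fin m) ℤ) (v : Fin (m + 2) → ℚ) :
    (((hyp A).map (Int.cast : ℤ → ℚ)).mulVec v) (Fin.last (m + 1)) = vfirst v := by
  rw [Matrix.mulVec, dotProduct, Finset.sum_eq_single 0]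
  · simp [hyp_last, vfirst]
  · intro j _ hj
    have : (j : ℕ) ≠ 0 := fun h => hj (Fin.ext h)
    simp [hyp_last, this]
  · simp

lemma hyp_mulVec_mid_s10 (A : Matrix (Fin m) (Fin m) ℤ) (v : Fin (m + 2) → ℚ) (i : Fin m) :
    (((hyp A).map (Int.cast : ℤ → ℚ)).mulVec v) i.castSucc.succ
      = ((A.map (Int.cast : ℤ → ℚ)).mulVec (vmid v)) i := by
  simp only [Matrix.mulVec, dotProduct, Matrix.map_apply]
  rw [Fin.sum_univ_succ, Fin.sum_univ_castSucc]
  simp only [hyp_mid_zero, hyp_mid_last, hyp_mid]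
  simp [vmid, Fin.succ, Fin.castSucc, Fin.castAdd, Fin.castLE]

lemma bilin_hyp (A : Matrix (Fin m) (Fin m) ℤ) (u v : Fin (m + 2) → ℚ) :
    bilin ℚ (hyp A) u v
      = vfirst u * vlast v + bilin ℚ A (vmid u) (vmid v) + vlast u * vfirst v := by
  rw [bilin, dotProduct, Fin.sum_univ_succ, Fin.sum_univ_castSucc]
  simp only [hyp_mulVec_zero_s10, hyp_mulVec_mid_s10, Fin.succ_last, hyp_mulVec_last_s10]
  simp only [bilin, dotProduct, ← add_assoc]
  rfl

end Hyperbolic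

section Scaling

variable {m : ℕ}

lemma bilin_smul_right (A : Matrix (Fin m) (Fin m) ℤ) (c : ℚ) (u v : Fin m → ℚ) :
    bilin ℚ A u (c • v) = c * bilin ℚ A u v := by
  simp [bilin, Matrix.mulVec_smul]

lemma quadF_smul (A : Matrix (Fin m) (Fin m) ℤ) (c : ℚ) (v : Fin m → ℚ) :
    quadF ℚ A (c • v) = c ^ 2 * quadF ℚ A v := by
  simp only [quadF, bilin, Matrix.mulVec_smul, smul_dotProduct, dotProduct_smul, smul_eq_mul]
  ring

lemma quadF_neg (A : Matrix (Fin m) (Fin m) ℤ) (v : Fin m → ℚ) :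
    quadF ℚ (-A) v = -quadF ℚ A v := by
  have : (-A).map (Int.cast : ℤ → ℚ) = -A.map (Int.cast : ℤ → ℚ) := by ext; simp
  simp only [quadF, bilin, this, Matrix.neg_mulVec, dotProduct_neg]
  ring

lemma quadF_MatS0 (S : Matrix (Fin m) (Fin m) ℤ) (v : Fin (m + 2) → ℚ) :
    quadF ℚ (MatS0 m S) v = vfirst v * vlast v - quadF ℚ S (vmid v) := by
  have h := quadF_neg S (vmid v)
  simp only [quadF] at h
  rw [quadF, MatS0, bilin_hyp, quadF]
  linarith

end Scaling

section Integrality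

variable {m : ℕ}

lemma inDual_of_inLat (A : Matrix (Fin m) (Fin m) ℤ) {v : Fin m → ℚ} (hv : inLat v) :
    inDual A v := by
  choose z hz using hv
  intro i
  refine ⟨A.mulVec z i, ?_⟩
  simp [Matrix.mulVec, dotProduct, hz]

lemma ratGcd_natCast_smul (k : ℕ) {w : Fin m → ℚ} (hw : inLat w) :
    ratGcd ((k : ℚ) • w) = k * ratGcd w := by
  choose z hz using hw
  have h : ∀ i, (((k : ℚ) • w) i).num.natAbs = k * ((w i).num.natAbs) := fun i => by
    have : ((k : ℚ) • w) i = ((k * z i : ℤ) : ℚ) := by simp [hz]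
    rw [this, hz, Rat.num_intCast, Rat.num_intCast, Int.natAbs_mul, Int.natAbs_natCast]
  simp only [ratGcd, h, Finset.gcd_mul_left, normalize_eq]

lemma ratGcd_dvd {w : Fin m → ℚ} (hw : inLat w) (i : Fin m) :
    ∃ z : ℤ, w i = (ratGcd w : ℚ) * z := by
  obtain ⟨z, hz⟩ := hw i
  have h : ratGcd w ∣ (w i).num.natAbs := Finset.gcd_dvd (Finset.mem_univ i)
  rw [hz, Rat.num_intCast, ← Int.natCast_dvd] at h
  obtain ⟨y, hy⟩ := h
  exact ⟨y, by rw [hz, hy]; push_cast; rfl⟩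

/-- A vector whose order is prime to `p` and which becomes integral after multiplication by a
power of `p` is integral. -/
lemma inLat_of_not_dvd_ordv {p k : ℕ} (hp : p.Prime) {v : Fin m → ℚ}
    (hv : inLat (((p ^ k : ℕ) : ℚ) • v)) (hord : ¬ p ∣ ordv v) : inLat v := by
  have hmem : ordv v ∈ {N : ℕ | 0 < N ∧ ∀ i, ∃ z : ℤ, (N : ℚ) * v i = (z : ℚ)} :=
    Nat.sInf_mem ⟨p ^ k, pow_pos hp.pos k, hv⟩
  have hcop : IsCoprime ((p ^ k : ℕ) : ℤ) (ordv v : ℤ) :=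
    Nat.isCoprime_iff_coprime.2 (((Nat.Prime.coprime_iff_not_dvd hp).2 hord).pow_left k)
  obtain ⟨a, b, hab⟩ := hcop
  intro i
  obtain ⟨x, hx⟩ := hv i
  obtain ⟨y, hy⟩ := hmem.2 i
  have hab' : (a : ℚ) * ((p ^ k : ℕ) : ℚ) + b * (ordv v : ℚ) = 1 := by exact_mod_cast hab
  rw [Pi.smul_apply, smul_eq_mul] at hx
  refine ⟨a * x + b * y, ?_⟩
  push_cast
  rw [← hx, ← hy]
  linear_combination -(v i) * hab'

end Integrality

section Extension

variable {n : ℕ} (S : Matrix (Fin n) (Fin n) ℤ)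

lemma vfirst_gExt (d : Fin (n + 2) → ℕ) (γ : ℕ) :
    vfirst (gExt n S d γ) = -(quadF ℚ (MatS0 n S) fun j => (d j : ℚ)) / γ := rfl

lemma vlast_gExt (d : Fin (n + 2) → ℕ) (γ : ℕ) : vlast (gExt n S d γ) = (γ : ℚ) := by
  simp [vlast, gExt]

lemma vmid_gExt (d : Fin (n + 2) → ℕ) (γ : ℕ) :
    vmid (gExt n S d γ) = fun i => (d i : ℚ) := by
  funext i
  have hi := i.isLt.ne
  simp [vmid, gExt, hi]

lemma natCast_smul_eq (k : ℕ) (d : Fin n → ℕ) :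
    (fun i => (((k • d) i : ℕ) : ℚ)) = (k : ℚ) • fun i => (d i : ℚ) := by
  funext i
  simp

lemma gExt_smul {k γ : ℕ} (hk : k ≠ 0) (d : Fin (n + 2) → ℕ) :
    gExt n S (k • d) (k * γ) = (k : ℚ) • gExt n S d γ := by
  have hk' : (k : ℚ) ≠ 0 := by exact_mod_cast hk
  funext i
  have hcast := natCast_smul_eq k d
  simp only [gExt, hcast, quadF_smul]
  simp only [gExt, Pi.smul_apply, smul_eq_mul]
  split_ifs
  · push_cast
    rw [mul_div_assoc', ← mul_div_mul_left _ (γ : ℚ) hk']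
    ring
  · push_cast; rfl
  · push_cast; rfl

lemma inLat_gExt {d : Fin (n + 2) → ℕ} {γ : ℕ} (hγ : γ ≠ 0)
    (h : ∃ e : ℤ, quadF ℚ (MatS0 n S) (fun j => (d j : ℚ)) = (γ : ℚ) * e) :
    inLat (gExt n S d γ) := by
  have hγ' : (γ : ℚ) ≠ 0 := by exact_mod_cast hγ
  obtain ⟨e, he⟩ := h
  intro i
  simp only [gExt]
  split_ifs
  · exact ⟨-e, by rw [he]; push_cast; field_simp⟩
  · exact ⟨γ, by push_cast; rfl⟩
  · exact ⟨_, (Int.cast_natCast _).symm⟩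

/-- The gcd condition scales along `(d, γ) ↦ (k d, k γ)`. -/
lemma ratGcd_gExt_smul {k γ : ℕ} (hk : k ≠ 0) (hγ : γ ≠ 0) {d : Fin (n + 2) → ℕ}
    (h : ∃ e : ℤ, quadF ℚ (MatS0 n S) (fun j => (d j : ℚ)) = (γ : ℚ) * e) :
    ratGcd (((MatS1 n S).map (Int.cast : ℤ → ℚ)).mulVec (gExt n S (k • d) (k * γ)))
      = k * ratGcd (((MatS1 n S).map (Int.cast : ℤ → ℚ)).mulVec (gExt n S d γ)) := by
  rw [gExt_smul S hk, Matrix.mulVec_smul]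
  exact ratGcd_natCast_smul k (inDual_of_inLat _ (inLat_gExt S hγ h))

/-- For `p`-maximal `S`, an isotropic vector of the dual of `L₁` that a power of `p` maps into
`L₁` already lies in `L₁`: this is the resulting descent for the vectors `gExt`. -/
lemma exists_smul_of_pMaximal {p : ℕ} (hp : p.Prime) (hmax : pMaximal n S p) {ν : ℕ}
    {v : Fin (n + 2) → ℕ}
    (h : ∃ e : ℤ, quadF ℚ (MatS0 n S) (fun j => (v j : ℚ)) = ((p ^ ν : ℕ) : ℚ) * e) :
    ∃ j ≤ ν, ∃ d : Fin (n + 2) → ℕ, v = p ^ (ν - j) • d ∧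
      (∃ e : ℤ, quadF ℚ (MatS0 n S) (fun i => (d i : ℚ)) = ((p ^ j : ℕ) : ℚ) * e) ∧
      ratGcd (((MatS1 n S).map (Int.cast : ℤ → ℚ)).mulVec (gExt n S d (p ^ j))) = 1 := by
  have hν : p ^ ν ≠ 0 := (pow_pos hp.pos ν).ne'
  set w := ((MatS1 n S).map (Int.cast : ℤ → ℚ)).mulVec (gExt n S v (p ^ ν)) with hw
  have hwint : inLat w := inDual_of_inLat _ (inLat_gExt S hν h)
  have hdvd := ratGcd_dvd hwint
  obtain ⟨k, hkν, hk⟩ : ∃ k ≤ ν, ratGcd w = p ^ k := by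
    rw [← Nat.dvd_prime_pow hp]
    obtain ⟨z, hz⟩ := hdvd 0
    rw [show w 0 = _ from hyp_mulVec_zero_s10 _ _, vlast_gExt] at hz
    rw [← Int.natCast_dvd_natCast]
    exact ⟨z, by exact_mod_cast hz⟩
  rw [hk] at hdvd
  have hk0 : p ^ k ≠ 0 := (pow_pos hp.pos k).ne'
  have hkQ : ((p ^ k : ℕ) : ℚ) ≠ 0 := by exact_mod_cast hk0
  have hνQ : ((p ^ ν : ℕ) : ℚ) ≠ 0 := by exact_mod_cast hν
  obtain ⟨e, he⟩ := h
  obtain ⟨e', he'⟩ : ∃ e' : ℤ, (e : ℚ) = ((p ^ k : ℕ) : ℚ) * e' := by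
    obtain ⟨z, hz⟩ := hdvd (Fin.last _)
    rw [show w (Fin.last _) = _ from hyp_mulVec_last_s10 _ _, vfirst_gExt, he] at hz
    refine ⟨-z, ?_⟩
    rw [neg_div, mul_div_cancel_left₀ _ hνQ] at hz
    push_cast at hz ⊢
    linarith
  have hmid : ∀ i, ∃ z : ℤ, (((MatS0 n S).map (Int.cast : ℤ → ℚ)).mulVec
      fun j => (v j : ℚ)) i = ((p ^ k : ℕ) : ℚ) * z := fun i => by
    obtain ⟨z, hz⟩ := hdvd i.castSucc.succ
    rw [show w i.castSucc.succ = _ from hyp_mulVec_mid_s10 _ _ _, vmid_gExt] at hz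
    exact ⟨z, hz⟩
  obtain ⟨a, ha⟩ := hmid (Fin.last _)
  obtain ⟨b, hb⟩ := hmid 0
  rw [MatS0, hyp_mulVec_last_s10] at ha
  rw [MatS0, hyp_mulVec_zero_s10] at hb
  obtain ⟨r, rfl⟩ := Nat.exists_eq_add_of_le hkν
  set μ : Fin n → ℚ := ((p ^ k : ℕ) : ℚ)⁻¹ • vmid (fun j => (v j : ℚ)) with hμ
  have hμv : vmid (fun j => (v j : ℚ)) = ((p ^ k : ℕ) : ℚ) • μ := by
    rw [hμ, smul_inv_smul₀ hkQ]
  have hμdual : inDual S μ := fun i => by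
    obtain ⟨z, hz⟩ := hmid i.castSucc.succ
    have hneg : (-S).map (Int.cast : ℤ → ℚ) = -S.map (Int.cast : ℤ → ℚ) := by ext; simp
    rw [MatS0, hyp_mulVec_mid_s10, hμv, Matrix.mulVec_smul, Pi.smul_apply, smul_eq_mul,
      mul_right_inj' hkQ, hneg, Matrix.neg_mulVec, Pi.neg_apply] at hz
    exact ⟨-z, by push_cast; linarith⟩
  have hμquad : ∃ z : ℤ, quadF ℚ S μ = (z : ℚ) := by
    refine ⟨a * b - (p ^ r : ℕ) * e', ?_⟩
    rw [quadF_MatS0, ha, hb, hμv, quadF_smul, he'] at he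
    have hsq := pow_ne_zero 2 hkQ
    apply mul_left_cancel₀ hsq
    push_cast at he ⊢
    rw [pow_add] at he
    linear_combination -he
  have hμint : inLat μ := by
    refine inLat_of_not_dvd_ordv (k := k) hp ?_ (hmax μ hμdual hμquad)
    rw [← hμv]
    exact fun i => ⟨_, (Int.cast_natCast _).symm⟩
  have hvdvd : ∀ i, ∃ z : ℤ, (v i : ℚ) = ((p ^ k : ℕ) : ℚ) * z := by
    intro i
    refine Fin.cases ⟨a, ha⟩ (fun i => ?_) i
    refine Fin.lastCases ⟨b, hb⟩ (fun i => ?_) i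
    obtain ⟨z, hz⟩ := hμint i
    have := congrFun hμv i
    rw [Pi.smul_apply, smul_eq_mul, hz] at this
    exact ⟨z, this⟩
  have hvnat : ∀ i, p ^ k ∣ v i := fun i => by
    obtain ⟨z, hz⟩ := hvdvd i
    rw [← Int.natCast_dvd_natCast]
    exact ⟨z, by exact_mod_cast hz⟩
  choose d hd using hvnat
  have hvd : v = p ^ k • d := funext hd
  have hdquad : ∃ e : ℤ, quadF ℚ (MatS0 n S) (fun i => (d i : ℚ)) = ((p ^ r : ℕ) : ℚ) * e := by
    refine ⟨e', ?_⟩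
    rw [hvd, natCast_smul_eq, quadF_smul, he'] at he
    apply mul_left_cancel₀ (pow_ne_zero 2 hkQ)
    push_cast at he ⊢
    rw [pow_add] at he
    linear_combination he
  refine ⟨r, Nat.le_add_left r k, d, by rwa [Nat.add_sub_cancel], hdquad, ?_⟩
  rw [hw, hvd, pow_add, ratGcd_gExt_smul S hk0 (pow_pos hp.pos r).ne' hdquad] at hk
  exact Nat.eq_of_mul_eq_mul_left (pow_pos hp.pos k) (by rw [hk, mul_one])

end Extension

end OEis

open scoped Classical in
/-- for `p`-maximal `S`, the convolved coefficient `b(λ,p^ν)`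
is the full exponential sum over `v ∈ (ℤ/p^νℤ)^{n+2}` with `p^ν ∣ Q₀(v)`. -/
theorem bCoef_eq_full_exponential_sum
    (n : ℕ) (hn : 1 ≤ n) (S : Matrix (Fin n) (Fin n) ℤ)
    (hsymm : S.IsSymm)
    (hpos : ∀ v : Fin n → ℝ, v ≠ 0 → 0 < bilin ℝ S v v)
    (heven : ∀ v : Fin n → ℤ, 2 ∣ v ⬝ᵥ S.mulVec v)
    (p : ℕ) (hp : p.Prime) (hmax : pMaximal n S p)
    (lam : Fin (n + 2) → ℚ) (hlam : inDual (MatS0 n S) lam)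
    (ν : ℕ) :
    bCoef n S lam (p ^ ν)
      = ∑ v ∈ Fintype.piFinset fun _ : Fin (n + 2) => Finset.range (p ^ ν),
          if ∃ e : ℤ, quadF ℚ (MatS0 n S) (fun i => (v i : ℚ)) = (p : ℚ) ^ ν * e then
            Complex.exp (2 * Real.pi * Complex.I *
              ((bilin ℚ (MatS0 n S) lam (fun i => (v i : ℚ)) / (p ^ ν : ℚ) : ℚ) : ℂ))
          else 0 := by
  simp only [bCoef, aCoef]
  rw [Nat.sum_divisors_prime_pow hp]
  simp only [← Finset.sum_filter]
  rw [Finset.sum_sigma']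
  have hmul : ∀ {j}, j < ν + 1 → p ^ (ν - j) * p ^ j = p ^ ν := fun hj => by
    rw [← pow_add, Nat.sub_add_cancel (Nat.le_of_lt_succ hj)]
  have hpos' : ∀ k, p ^ k ≠ 0 := fun k => (pow_pos hp.pos k).ne'
  refine Finset.sum_bij (fun x _ => p ^ (ν - x.1) • x.2) ?_ ?_ ?_ ?_
  · rintro ⟨j, d⟩ hx
    simp only [Finset.mem_sigma, Finset.mem_filter, Fintype.mem_piFinset, Finset.mem_range] at hx ⊢
    obtain ⟨hj, hd, ⟨e, he⟩, -⟩ := hx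
    refine ⟨fun i => ?_, (p ^ (ν - j) : ℕ) * e, ?_⟩
    · rw [← hmul hj, Pi.smul_apply, smul_eq_mul]
      exact Nat.mul_lt_mul_of_pos_left (hd i) (pow_pos hp.pos _)
    · rw [natCast_smul_eq, quadF_smul, he, ← Nat.cast_pow p ν, ← hmul hj]
      push_cast
      ring
  · rintro ⟨j, d⟩ hx ⟨j', d'⟩ hx' heq
    simp only [Finset.mem_sigma, Finset.mem_filter, Fintype.mem_piFinset, Finset.mem_range]
      at hx hx' heq
    obtain ⟨hj, -, he, hg⟩ := hx
    obtain ⟨hj', -, he', hg'⟩ := hx'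
    have h₁ := ratGcd_gExt_smul S (hpos' (ν - j)) (hpos' j) he
    have h₂ := ratGcd_gExt_smul S (hpos' (ν - j')) (hpos' j') he'
    rw [hg, mul_one, hmul hj] at h₁
    rw [hg', mul_one, hmul hj', ← heq, h₁] at h₂
    have hjj := Nat.pow_right_injective hp.two_le h₂
    obtain rfl : j = j' := by omega
    obtain rfl : d = d' := smul_right_injective _ (hpos' (ν - j)) heq
    rfl
  · intro v hv
    simp only [Finset.mem_filter, Fintype.mem_piFinset, Finset.mem_range] at hv
    obtain ⟨hlt, e, he⟩ := hv
    obtain ⟨j, hj, d, rfl, hquad, hg⟩ :=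
      exists_smul_of_pMaximal S hp hmax ⟨e, by rw [he]; push_cast; rfl⟩
    refine ⟨⟨j, d⟩, ?_, rfl⟩
    simp only [Finset.mem_sigma, Finset.mem_filter, Fintype.mem_piFinset, Finset.mem_range]
    refine ⟨Nat.lt_succ_of_le hj, fun i => ?_, hquad, hg⟩
    have := hlt i
    rw [← hmul (Nat.lt_succ_of_le hj), Pi.smul_apply, smul_eq_mul] at this
    exact Nat.lt_of_mul_lt_mul_left this
  · rintro ⟨j, d⟩ hx
    simp only [Finset.mem_sigma, Finset.mem_range] at hx
    have hk : ((p ^ (ν - j) : ℕ) : ℚ) ≠ 0 := by exact_mod_cast hpos' (ν - j)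
    rw [natCast_smul_eq, bilin_smul_right, ← Nat.cast_pow p ν, ← hmul hx.1, Nat.cast_mul,
      mul_div_mul_left _ _ hk]
end
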